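/- arXiv:0907.0724 — 4 statements merged into one kernel-verified Lean document; each statement's English description precedes it below -/
import Mathlib

section
/- If a finite set S of points in the plane ℝ² has exactly r points on a line l and exactly s points not on l, then the number of lines containing exactly two points of S satisfies t₂ ≥ rs − s(s−1). -/
open Set

noncomputable section

/-- The plane. -/
abbrev Pt2 := EuclideanSpace ℝ (Fin 2)

/-- A line in the plane: the affine span of two distinct points. -/
def IsLine (L : Set Pt2) : Prop :=
  ∃ p q : Pt2, p ≠ q ∧ L = (affineSpan ℝ ({p, q} : Set Pt2) : Set Pt2)

/-- `lineCount S k` is the number of lines containing exactly `k` points of `S`. -/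
def lineCount (S : Set Pt2) (k : ℕ) : ℕ :=
  {L : Set Pt2 | IsLine L ∧ (S ∩ L).ncard = k}.ncard

/-- A line equals the affine span of any two distinct points on it. -/
theorem IsLine.eq_affineSpan {L : Set Pt2} (hL : IsLine L) {a b : Pt2} (ha : a ∈ L) (hb : b ∈ L)
    (hab : a ≠ b) : L = (affineSpan ℝ ({a, b} : Set Pt2) : Set Pt2) := by
  obtain ⟨p, q, -, rfl⟩ := hL
  rw [affineSpan_pair_eq_of_mem_of_mem_of_ne ha hb hab]

/-- Two lines sharing two distinct points are equal. -/
theorem IsLine.eq_of_mem {L M : Set Pt2} (hL : IsLine L) (hM : IsLine M) {a b : Pt2}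
    (hab : a ≠ b) (haL : a ∈ L) (hbL : b ∈ L) (haM : a ∈ M) (hbM : b ∈ M) : L = M :=
  (hL.eq_affineSpan haL hbL hab).trans (hM.eq_affineSpan haM hbM hab).symm

/-- A finite set of points has only finitely many ordinary lines. -/
theorem finite_ordinary_lines {S : Set Pt2} (hS : S.Finite) :
    {L : Set Pt2 | IsLine L ∧ (S ∩ L).ncard = 2}.Finite := by
  refine Set.Finite.of_finite_image (f := fun L => S ∩ L)
    (hS.finite_subsets.subset ?_) ?_
  · rintro _ ⟨L, -, rfl⟩
    exact Set.inter_subset_left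
  · rintro L ⟨hL, hL2⟩ M ⟨hM, -⟩ (hLM : S ∩ L = S ∩ M)
    obtain ⟨a, b, hab, h⟩ := Set.ncard_eq_two.1 hL2
    have ha : a ∈ S ∩ L := by simp [h]
    have hb : b ∈ S ∩ L := by simp [h]
    exact hL.eq_of_mem hM hab ha.2 hb.2 (hLM ▸ ha).2 (hLM ▸ hb).2

theorem ncard_offDiag_add_ncard {α : Type*} {B : Set α} (hB : B.Finite) :
    B.offDiag.ncard + B.ncard = B.ncard * B.ncard := by
  classical
  lift B to Finset α using hB
  rw [← Finset.coe_offDiag, Set.ncard_coe_finset, Set.ncard_coe_finset, Finset.offDiag_card]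
  exact Nat.sub_add_cancel (Nat.le_mul_self _)

theorem stmt0 (S : Set Pt2) (hS : S.Finite) (l : Set Pt2) (hl : IsLine l)
    (r s : ℕ) (hr : (S ∩ l).ncard = r) (hs : (S \ l).ncard = s) :
    (lineCount S 2 : ℤ) ≥ (r : ℤ) * s - s * (s - 1) := by
  have isLine {p q : Pt2} (h : p ≠ q) : IsLine (affineSpan ℝ ({p, q} : Set Pt2) : Set Pt2) :=
    ⟨p, q, h, rfl⟩
  have ne {x : Pt2 × Pt2} (hx : x ∈ (S ∩ l) ×ˢ (S \ l)) : x.1 ≠ x.2 :=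
    fun h => hx.2.2 (h ▸ hx.1.2)
  have left_mem (p q : Pt2) : p ∈ (affineSpan ℝ ({p, q} : Set Pt2) : Set Pt2) :=
    left_mem_affineSpan_pair ℝ p q
  have right_mem (p q : Pt2) : q ∈ (affineSpan ℝ ({p, q} : Set Pt2) : Set Pt2) :=
    right_mem_affineSpan_pair ℝ p q
  have fst_eq {L : Set Pt2} (hL : IsLine L) {a b q : Pt2} (haL : a ∈ L) (hbL : b ∈ L)
      (ha : a ∈ l) (hb : b ∈ l) (hqL : q ∈ L) (hq : q ∉ l) : a = b := by
    by_contra hab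
    exact hq (hL.eq_of_mem hl hab haL hbL ha hb ▸ hqL)
  let G : Set (Pt2 × Pt2) :=
    {x | S ∩ (affineSpan ℝ ({x.1, x.2} : Set Pt2) : Set Pt2) ⊆ {x.1, x.2}}
  have hfin : ((S ∩ l) ×ˢ (S \ l)).Finite := (hS.inter_of_left l).prod hS.sdiff
  have good : (((S ∩ l) ×ˢ (S \ l)) ∩ G).ncard ≤ lineCount S 2 := by
    refine Set.ncard_le_ncard_of_injOn
      (fun x => (affineSpan ℝ ({x.1, x.2} : Set Pt2) : Set Pt2)) ?_ ?_
      (finite_ordinary_lines hS)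
    · rintro x ⟨hx, hxG⟩
      refine ⟨isLine (ne hx), ?_⟩
      rw [Set.Subset.antisymm hxG, Set.ncard_pair (ne hx)]
      rintro z (rfl | rfl)
      · exact ⟨hx.1.1, left_mem _ _⟩
      · exact ⟨hx.2.1, right_mem _ _⟩
    · rintro x ⟨hx, hxG⟩ y ⟨hy, -⟩ hxy
      have h1 := left_mem y.1 y.2
      have h2 := right_mem y.1 y.2
      dsimp only at hxy
      rw [← hxy] at h1 h2
      refine Prod.ext
        (fst_eq (isLine (ne hx)) (left_mem _ _) h1 hx.1.2 hy.1.2 (right_mem _ _) hx.2.2) ?_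
      rcases hxG ⟨hy.2.1, h2⟩ with h | h
      · exact (hy.2.2 (h ▸ hx.1.2)).elim
      · exact h.symm
  have bad : (((S ∩ l) ×ˢ (S \ l)) \ G).ncard ≤ (S \ l).offDiag.ncard := by
    have third (x : Pt2 × Pt2) : ∃ c, x ∉ G →
        c ∈ S ∧ c ∈ (affineSpan ℝ ({x.1, x.2} : Set Pt2) : Set Pt2) ∧ c ≠ x.1 ∧ c ≠ x.2 := by
      by_cases hx : x ∈ G
      · exact ⟨0, fun h => (h hx).elim⟩
      · obtain ⟨c, hc, hc'⟩ := Set.not_subset.1 hx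
        refine ⟨c, fun _ => ⟨hc.1, hc.2, ?_, ?_⟩⟩ <;> rintro rfl <;> simp at hc'
    choose c hc using third
    refine Set.ncard_le_ncard_of_injOn (fun x => (x.2, c x)) ?_ ?_
      ((hS.sdiff.prod hS.sdiff).subset (Set.offDiag_subset_prod _))
    · rintro x ⟨hx, hxG⟩
      obtain ⟨hcS, hcL, hc1, hc2⟩ := hc x hxG
      refine ⟨hx.2, ⟨hcS, fun hcl => hc1 ?_⟩, hc2.symm⟩
      exact fst_eq (isLine (ne hx)) hcL (left_mem _ _) hcl hx.1.2 (right_mem _ _) hx.2.2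
    · rintro x ⟨hx, hxG⟩ y ⟨hy, hyG⟩ hxy
      obtain ⟨h2, hcc⟩ := Prod.mk.inj hxy
      obtain ⟨-, hcL, -, hc2⟩ := hc x hxG
      obtain ⟨-, hcL', -, -⟩ := hc y hyG
      have hL := (isLine (ne hx)).eq_of_mem (isLine (ne hy)) hc2.symm (right_mem _ _) hcL
        (h2 ▸ right_mem _ _) (hcc ▸ hcL')
      exact Prod.ext (fst_eq (isLine (ne hx)) (left_mem _ _) (hL ▸ left_mem _ _)
        hx.1.2 hy.1.2 (right_mem _ _) hx.2.2) h2
  have total := Set.ncard_inter_add_ncard_sdiff_eq_ncard ((S ∩ l) ×ˢ (S \ l)) G hfin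
  have hoff := ncard_offDiag_add_ncard (B := S \ l) hS.sdiff
  rw [Set.ncard_prod, hr, hs] at total
  rw [hs] at hoff
  zify at good bad total hoff
  linarith
end
end

section
/- For any finite set S of points in ℝ², not all collinear, the number of determined lines containing at most three points of S satisfies t₂ + t₃ ≥ (t + 3)/2, where t is the total number of determined lines. -/
open Set

noncomputable section

/-- The lines determined by `S`: lines containing at least two points of `S`. -/
def detLines (S : Set Pt2) : Set (Set Pt2) :=
  {L : Set Pt2 | IsLine L ∧ 2 ≤ (S ∩ L).ncard}

namespace Melchior

/-- The height of the point `c` above the line `y = l.1 * x + l.2`. -/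
def height (l c : ℝ × ℝ) : ℝ := c.2 - l.1 * c.1 - l.2

/-- The line of slope-intercept form through two points with distinct abscissae. -/
def lineThrough (p q : ℝ × ℝ) : ℝ × ℝ :=
  ((q.2 - p.2) / (q.1 - p.1), p.2 - (q.2 - p.2) / (q.1 - p.1) * p.1)

/-- The points of `P` on the line `l`. -/
def onLine (P : Finset (ℝ × ℝ)) (l : ℝ × ℝ) : Finset (ℝ × ℝ) := {c ∈ P | height l c = 0}

/-- The lines through at least two points of `P`. -/
def lines (P : Finset (ℝ × ℝ)) : Finset (ℝ × ℝ) :=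
  {l ∈ (P ×ˢ P).image (fun z => lineThrough z.1 z.2) | 2 ≤ (onLine P l).card}

lemma height_lineThrough (p q c : ℝ × ℝ) :
    height (lineThrough p q) c = c.2 - p.2 - (q.2 - p.2) / (q.1 - p.1) * (c.1 - p.1) := by
  simp only [height, lineThrough]; ring

lemma eq_lineThrough {l p q : ℝ × ℝ} (h : p.1 ≠ q.1) (hp : height l p = 0)
    (hq : height l q = 0) : l = lineThrough p q := by
  have h' : q.1 - p.1 ≠ 0 := sub_ne_zero.2 h.symm
  simp only [height] at hp hq
  have hm : l.1 = (q.2 - p.2) / (q.1 - p.1) := by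
    rw [eq_div_iff h']; linarith
  ext
  · exact hm
  · simp only [lineThrough]; rw [← hm]; linarith

lemma mem_lines {P : Finset (ℝ × ℝ)} (hx : Set.InjOn Prod.fst (P : Set (ℝ × ℝ))) {l : ℝ × ℝ} :
    l ∈ lines P ↔ 2 ≤ (onLine P l).card := by
  simp only [lines, Finset.mem_filter, and_iff_right_iff_imp]
  intro h
  obtain ⟨p, hp, q, hq, hpq⟩ := Finset.one_lt_card.1 h
  simp only [onLine, Finset.mem_filter] at hp hq
  refine Finset.mem_image.2 ⟨(p, q), Finset.mk_mem_product hp.1 hq.1, ?_⟩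
  exact (eq_lineThrough (fun e => hpq (hx hp.1 hq.1 e)) hp.2 hq.2).symm

lemma mem_lines_of_two {P : Finset (ℝ × ℝ)} (hx : Set.InjOn Prod.fst (P : Set (ℝ × ℝ)))
    {l p q : ℝ × ℝ} (hp : p ∈ P) (hq : q ∈ P) (hpq : p ≠ q) (hlp : height l p = 0)
    (hlq : height l q = 0) : l ∈ lines P :=
  (mem_lines hx).2 (Finset.one_lt_card.2
    ⟨p, Finset.mem_filter.2 ⟨hp, hlp⟩, q, Finset.mem_filter.2 ⟨hq, hlq⟩, hpq⟩)

/-- Pairs of a determined line and a point of `P` on it that is not the rightmost one. -/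
def gaps (P : Finset (ℝ × ℝ)) : Finset ((_ : ℝ × ℝ) × (ℝ × ℝ)) :=
  (lines P).sigma fun l => {p ∈ onLine P l | ∃ q ∈ onLine P l, p.1 < q.1}

/-- The points of `P` above the line obtained by turning `z.1` slightly counterclockwise around
a point just to the right of `z.2`. -/
def upperPart (P : Finset (ℝ × ℝ)) (z : (_ : ℝ × ℝ) × (ℝ × ℝ)) : Finset (ℝ × ℝ) :=
  {c ∈ P | 0 < height z.1 c ∨ height z.1 c = 0 ∧ c.1 ≤ z.2.1}

/-- The points of `P` above the line obtained by translating `s.1` slightly down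
(if `s.2` is `true`) or up. -/
def sidePart (P : Finset (ℝ × ℝ)) (s : (ℝ × ℝ) × Bool) : Finset (ℝ × ℝ) :=
  {c ∈ P | if s.2 then 0 ≤ height s.1 c else 0 < height s.1 c}

lemma card_gaps {P : Finset (ℝ × ℝ)} (hx : Set.InjOn Prod.fst (P : Set (ℝ × ℝ))) :
    (gaps P).card = ∑ l ∈ lines P, ((onLine P l).card - 1) := by
  rw [gaps, Finset.card_sigma]
  refine Finset.sum_congr rfl fun l hl => ?_
  have h2 := (mem_lines hx).1 hl
  obtain ⟨r, hr, hmax⟩ := (onLine P l).exists_max_image Prod.fst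
    (Finset.card_pos.1 (by omega))
  rw [← Finset.card_erase_of_mem hr]
  congr 1
  ext p
  simp only [Finset.mem_filter, Finset.mem_erase]
  constructor
  · rintro ⟨hp, q, hq, hlt⟩
    refine ⟨?_, hp⟩
    rintro rfl
    exact absurd (hmax q hq) (not_le.2 hlt)
  · rintro ⟨hne, hp⟩
    refine ⟨hp, r, hr, lt_of_le_of_ne (hmax p hp) fun e => hne ?_⟩
    exact hx (Finset.mem_filter.1 hp).1 (Finset.mem_filter.1 hr).1 e

lemma mem_gaps {P : Finset (ℝ × ℝ)} {z : (_ : ℝ × ℝ) × (ℝ × ℝ)} :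
    z ∈ gaps P ↔ z.1 ∈ lines P ∧ (z.2 ∈ P ∧ height z.1 z.2 = 0) ∧
      ∃ q, (q ∈ P ∧ height z.1 q = 0) ∧ z.2.1 < q.1 := by
  rw [gaps, Finset.mem_sigma, Finset.mem_filter]
  simp only [onLine, Finset.mem_filter]

lemma height_nonneg_of_mem {P : Finset (ℝ × ℝ)} {z : (_ : ℝ × ℝ) × (ℝ × ℝ)} {c : ℝ × ℝ}
    (h : c ∈ upperPart P z) : 0 ≤ height z.1 c := by
  rcases (Finset.mem_filter.1 h).2 with h | h
  · exact h.le
  · exact h.1.ge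

lemma height_nonpos_of_notMem {P : Finset (ℝ × ℝ)} {z : (_ : ℝ × ℝ) × (ℝ × ℝ)} {c : ℝ × ℝ}
    (hc : c ∈ P) (h : c ∉ upperPart P z) : height z.1 c ≤ 0 := by
  by_contra! h'
  exact h (Finset.mem_filter.2 ⟨hc, Or.inl h'⟩)

lemma left_mem_upperPart {P : Finset (ℝ × ℝ)} {z : (_ : ℝ × ℝ) × (ℝ × ℝ)}
    (hp : z.2 ∈ P ∧ height z.1 z.2 = 0) : z.2 ∈ upperPart P z :=
  Finset.mem_filter.2 ⟨hp.1, Or.inr ⟨hp.2, le_rfl⟩⟩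

lemma right_notMem_upperPart {P : Finset (ℝ × ℝ)} {z : (_ : ℝ × ℝ) × (ℝ × ℝ)} {q : ℝ × ℝ}
    (hq : height z.1 q = 0) (h : z.2.1 < q.1) : q ∉ upperPart P z := by
  intro hm
  rcases (Finset.mem_filter.1 hm).2 with h' | h'
  · exact h'.ne' hq
  · exact absurd h'.2 (not_le.2 h)

lemma slope_le {l l' p q : ℝ × ℝ} (hp : height l p = 0) (hq : height l q = 0) (h : p.1 < q.1)
    (hp' : 0 ≤ height l' p) (hq' : height l' q ≤ 0) : l.1 ≤ l'.1 := by
  simp only [height] at *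
  by_contra! hlt
  nlinarith [mul_pos (sub_pos.2 hlt) (sub_pos.2 h)]

lemma slope_ge {l l' p q : ℝ × ℝ} (hp : height l p = 0) (hq : height l q = 0) (h : p.1 < q.1)
    (hp' : height l' p ≤ 0) (hq' : 0 ≤ height l' q) : l'.1 ≤ l.1 := by
  simp only [height] at *
  by_contra! hlt
  nlinarith [mul_pos (sub_pos.2 hlt) (sub_pos.2 h)]

lemma line_eq_of_slope_eq {l l' p q : ℝ × ℝ} (hp : height l p = 0) (hq : height l q = 0)
    (hm : l.1 = l'.1) (hp' : 0 ≤ height l' p) (hq' : height l' q ≤ 0) : l = l' := by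
  simp only [height] at *
  rw [hm] at hp hq
  exact Prod.ext hm (by linarith)

lemma gap_eq_of_upperPart_eq {P : Finset (ℝ × ℝ)} (hx : Set.InjOn Prod.fst (P : Set (ℝ × ℝ)))
    {z z' : (_ : ℝ × ℝ) × (ℝ × ℝ)} (hz : z ∈ gaps P) (hz' : z' ∈ gaps P)
    (h : upperPart P z = upperPart P z') : z = z' := by
  obtain ⟨-, hp, q, hq, hlt⟩ := mem_gaps.1 hz
  obtain ⟨-, hp', q', hq', hlt'⟩ := mem_gaps.1 hz'
  have h1 := left_mem_upperPart hp
  have h2 := right_notMem_upperPart (P := P) hq.2 hlt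
  have h1' := left_mem_upperPart hp'
  have h2' := right_notMem_upperPart (P := P) hq'.2 hlt'
  rw [h] at h1 h2
  rw [← h] at h1' h2'
  have a1 := height_nonneg_of_mem h1
  have a2 := height_nonpos_of_notMem hq.1 h2
  have a1' := height_nonneg_of_mem h1'
  have a2' := height_nonpos_of_notMem hq'.1 h2'
  have hl : z.1 = z'.1 := line_eq_of_slope_eq hp.2 hq.2
    (le_antisymm (slope_le hp.2 hq.2 hlt a1 a2) (slope_le hp'.2 hq'.2 hlt' a1' a2')) a1 a2
  have b1 : z.2.1 ≤ z'.2.1 := by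
    rcases (Finset.mem_filter.1 h1).2 with h | h
    · rw [← hl, hp.2] at h; exact absurd h (lt_irrefl _)
    · exact h.2
  have b2 : z'.2.1 ≤ z.2.1 := by
    rcases (Finset.mem_filter.1 h1').2 with h | h
    · rw [hl, hp'.2] at h; exact absurd h (lt_irrefl _)
    · exact h.2
  exact Sigma.ext hl (heq_of_eq (hx hp.1 hp'.1 (le_antisymm b1 b2)))

lemma upperPart_ne_compl {P : Finset (ℝ × ℝ)} (hcol : ∀ l, ∃ c ∈ P, height l c ≠ 0)
    {z z' : (_ : ℝ × ℝ) × (ℝ × ℝ)} (hz : z ∈ gaps P) (hz' : z' ∈ gaps P) :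
    upperPart P z ≠ P \ upperPart P z' := by
  intro h
  have hiff : ∀ c ∈ P, (c ∈ upperPart P z ↔ c ∉ upperPart P z') := by
    intro c hc
    rw [h, Finset.mem_sdiff]
    simp [hc]
  obtain ⟨-, hp, q, hq, hlt⟩ := mem_gaps.1 hz
  obtain ⟨-, hp', q', hq', hlt'⟩ := mem_gaps.1 hz'
  have h1 := (hiff _ hp.1).1 (left_mem_upperPart hp)
  have h2 := (not_iff_not.2 (hiff _ hq.1)).1 (right_notMem_upperPart (P := P) hq.2 hlt)
  have h1' := fun e => (hiff _ hp'.1).1 e (left_mem_upperPart hp')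
  have h2' := (hiff _ hq'.1).2 (right_notMem_upperPart (P := P) hq'.2 hlt')
  have a1 := height_nonpos_of_notMem hp.1 h1
  have a2 := height_nonneg_of_mem (not_not.1 h2)
  have a1' := height_nonpos_of_notMem hp'.1 h1'
  have a2' := height_nonneg_of_mem h2'
  have hl : z.1 = z'.1 := line_eq_of_slope_eq hq.2 hp.2
    (le_antisymm (slope_ge hp'.2 hq'.2 hlt' a1' a2') (slope_ge hp.2 hq.2 hlt a1 a2)) a2 a1
  obtain ⟨c, hc, hne⟩ := hcol z.1
  by_cases hcz : c ∈ upperPart P z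
  · refine hne (le_antisymm ?_ (height_nonneg_of_mem hcz))
    rw [hl]; exact height_nonpos_of_notMem hc ((hiff c hc).1 hcz)
  · refine hne (le_antisymm (height_nonpos_of_notMem hc hcz) ?_)
    rw [hl]
    exact height_nonneg_of_mem (not_not.1 fun e => hcz ((hiff c hc).2 e))

/-- If two points `r` and `c` are points of `P` lying on the line on which the affine function
`x - r.1 - τ * height l` vanishes, and this function is nonpositive on `A`, positive on `P \ A`,
then `A` or its complement is a side part. -/
lemma exists_side_of_sep {P A : Finset (ℝ × ℝ)} (hx : Set.InjOn Prod.fst (P : Set (ℝ × ℝ)))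
    (hA : A ⊆ P) {l r c : ℝ × ℝ} {τ : ℝ} (hr : r ∈ P) (hc : c ∈ P) (hrc : r ≠ c)
    (hlr : height l r = 0) (hlc : c.1 - r.1 - τ * height l c = 0)
    (hsep : (∀ a ∈ P, (a ∈ A ↔ a.1 - r.1 - τ * height l a ≤ 0)) ∨
      (∀ a ∈ P, (a ∈ A ↔ a.1 - r.1 - τ * height l a < 0))) :
    ∃ s ∈ lines P ×ˢ (Finset.univ : Finset Bool),
      sidePart P s = A ∨ sidePart P s = P \ A := by
  have hτ : τ ≠ 0 := by
    rintro rfl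
    exact hrc (hx hr hc (by linarith))
  obtain ⟨l', hl'⟩ : ∃ l' : ℝ × ℝ, ∀ a, a.1 - r.1 - τ * height l a = -τ * height l' a := by
    refine ⟨(l.1 + 1 / τ, l.2 - r.1 / τ), fun a => ?_⟩
    simp only [height]; field_simp; ring
  have hmem : l' ∈ lines P := by
    refine mem_lines_of_two hx hr hc hrc ?_ ?_
    · have := hl' r
      rw [hlr] at this
      simpa [hτ] using this
    · have := hl' c
      rw [hlc] at this
      simpa [hτ] using this.symm
  simp only [hl'] at hsep
  have hms : ∀ b : Bool, (l', b) ∈ lines P ×ˢ (Finset.univ : Finset Bool) := fun b =>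
    Finset.mk_mem_product hmem (Finset.mem_univ b)
  have key : ∀ {Q : ℝ × ℝ → Prop}, (∀ a ∈ P, (a ∈ A ↔ Q a)) → ∀ a, a ∈ A ↔ a ∈ P ∧ Q a :=
    fun h a => ⟨fun ha => ⟨hA ha, (h a (hA ha)).1 ha⟩, fun ha => (h a ha.1).2 ha.2⟩
  rcases lt_or_gt_of_ne hτ with hneg | hpos
  · have e1 : ∀ y : ℝ, -τ * y ≤ 0 ↔ ¬ 0 < y := fun y => by
      rw [not_lt]; constructor <;> intro h <;> nlinarith
    have e2 : ∀ y : ℝ, -τ * y < 0 ↔ ¬ 0 ≤ y := fun y => by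
      rw [not_le]; constructor <;> intro h <;> nlinarith
    rcases hsep with h | h
    · refine ⟨(l', false), hms _, Or.inr ?_⟩
      ext a
      simp only [sidePart, Finset.mem_filter, Finset.mem_sdiff, key h, e1]
      simp; tauto
    · refine ⟨(l', true), hms _, Or.inr ?_⟩
      ext a
      simp only [sidePart, Finset.mem_filter, Finset.mem_sdiff, key h, e2]
      simp; tauto
  · have e1 : ∀ y : ℝ, -τ * y ≤ 0 ↔ 0 ≤ y := fun y => by
      constructor <;> intro h <;> nlinarith
    have e2 : ∀ y : ℝ, -τ * y < 0 ↔ 0 < y := fun y => by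
      constructor <;> intro h <;> nlinarith
    rcases hsep with h | h
    · refine ⟨(l', true), hms _, Or.inl ?_⟩
      ext a
      simp only [sidePart, Finset.mem_filter, key h, e1, if_true]
    · refine ⟨(l', false), hms _, Or.inl ?_⟩
      ext a
      simp only [sidePart, Finset.mem_filter, key h, e2, Bool.false_eq_true, if_false]

lemma exists_side {P : Finset (ℝ × ℝ)} (hx : Set.InjOn Prod.fst (P : Set (ℝ × ℝ)))
    (hcol : ∀ l, ∃ c ∈ P, height l c ≠ 0)
    {z : (_ : ℝ × ℝ) × (ℝ × ℝ)} (hz : z ∈ gaps P) :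
    ∃ s ∈ lines P ×ˢ (Finset.univ : Finset Bool),
      sidePart P s = upperPart P z ∨ sidePart P s = P \ upperPart P z := by
  obtain ⟨-, hp, q₀, hq₀, hlt₀⟩ := mem_gaps.1 hz
  obtain ⟨l, p⟩ := z
  simp only at hp hq₀ hlt₀
  -- the point of `P` on `l` following `p`
  obtain ⟨q, hq, hmin⟩ := Finset.exists_min_image {c ∈ P | height l c = 0 ∧ p.1 < c.1} Prod.fst
    ⟨q₀, Finset.mem_filter.2 ⟨hq₀.1, hq₀.2, hlt₀⟩⟩
  obtain ⟨hqP, hql, hlt⟩ := Finset.mem_filter.1 hq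
  have hmin' : ∀ c ∈ P, height l c = 0 → p.1 < c.1 → q.1 ≤ c.1 := fun c hc h hpc =>
    hmin c (Finset.mem_filter.2 ⟨hc, h, hpc⟩)
  -- the first point hit when turning `l` counterclockwise around `p` or `q`
  obtain ⟨c, hc, hmax⟩ := Finset.exists_max_image {c ∈ P | height l c ≠ 0}
    (fun c => (c.1 - if 0 < height l c then p.1 else q.1) / height l c)
    (by obtain ⟨c, hc, h⟩ := hcol l; exact ⟨c, Finset.mem_filter.2 ⟨hc, h⟩⟩)
  obtain ⟨hcP, hcl⟩ := Finset.mem_filter.1 hc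
  have hmax' : ∀ a ∈ P, height l a ≠ 0 → _ := fun a ha h =>
    hmax a (Finset.mem_filter.2 ⟨ha, h⟩)
  set τ := (c.1 - if 0 < height l c then p.1 else q.1) / height l c with hτ
  have hup : ∀ a ∈ P, 0 < height l a → a.1 - p.1 - τ * height l a ≤ 0 := fun a ha h => by
    have := hmax' a ha h.ne'
    rw [if_pos h, div_le_iff₀ h] at this
    linarith
  have hdown : ∀ a ∈ P, height l a < 0 → 0 ≤ a.1 - q.1 - τ * height l a := fun a ha h => by
    have := hmax' a ha h.ne
    rw [if_neg h.not_gt, div_le_iff_of_neg h] at this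
    linarith
  have hA : upperPart P ⟨l, p⟩ ⊆ P := Finset.filter_subset _ _
  by_cases hpos : 0 < height l c
  · rw [if_pos hpos] at hτ
    refine exists_side_of_sep (τ := τ) (l := l) hx hA hp.1 hcP ?_ hp.2 ?_ (Or.inl ?_)
    · rintro rfl; exact hcl hp.2
    · rw [hτ]; field_simp; ring
    · intro a ha
      simp only [upperPart, Finset.mem_filter, ha, true_and]
      rcases lt_trichotomy (height l a) 0 with h | h | h
      · have := hdown a ha h
        simp only [h.not_gt, h.ne, false_and, or_self, false_iff, not_le]
        linarith
      · simp [h]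
      · simp [h, hup a ha h]
  · rw [if_neg hpos] at hτ
    refine exists_side_of_sep (τ := τ) (l := l) hx hA hqP hcP ?_ hql ?_ (Or.inr ?_)
    · rintro rfl; exact hcl hql
    · rw [hτ]; field_simp; ring
    · intro a ha
      simp only [upperPart, Finset.mem_filter, ha, true_and]
      rcases lt_trichotomy (height l a) 0 with h | h | h
      · have := hdown a ha h
        simp only [h.not_gt, h.ne, false_and, or_self, false_iff, not_lt]
        linarith
      · simp only [h, lt_irrefl, true_and, false_or, mul_zero, sub_zero]
        constructor
        · intro h'; linarith
        · intro h'; by_contra! h''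
          have := hmin' a ha h h''
          linarith
      · have := hup a ha h
        simp only [h, true_or, true_iff]
        linarith

/-- At a leftmost (`σ = 1`) or rightmost (`σ = -1`) point there are a lower (`τ = 1`) and an
upper (`τ = -1`) supporting line. -/
lemma exists_support {P : Finset (ℝ × ℝ)} (hx : Set.InjOn Prod.fst (P : Set (ℝ × ℝ)))
    {p : ℝ × ℝ} (hp : p ∈ P) (hne : ∃ c ∈ P, c ≠ p) {σ τ : ℝ} (hσ : σ * σ = 1)
    (h : ∀ c ∈ P, 0 ≤ σ * (c.1 - p.1)) :
    ∃ l ∈ lines P, height l p = 0 ∧ ∀ c ∈ P, 0 ≤ τ * height l c := by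
  obtain ⟨q, hq, hmin⟩ := Finset.exists_min_image (P.erase p)
    (fun c => τ * σ * ((c.2 - p.2) / (c.1 - p.1)))
    (by obtain ⟨c, hc, h⟩ := hne; exact ⟨c, Finset.mem_erase.2 ⟨h, hc⟩⟩)
  obtain ⟨hqp, hqP⟩ := Finset.mem_erase.1 hq
  have hd : ∀ c ∈ P, c ≠ p → c.1 - p.1 ≠ 0 := fun c hc hcp e => hcp (hx hc hp (by linarith))
  have hlp : height (lineThrough p q) p = 0 := by rw [height_lineThrough]; ring
  refine ⟨lineThrough p q, ?_, hlp, fun c hc => ?_⟩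
  · refine mem_lines_of_two hx hp hqP hqp.symm hlp ?_
    rw [height_lineThrough, div_mul_cancel₀ _ (hd q hqP hqp)]; ring
  · by_cases hcp : c = p
    · rw [hcp, hlp]; simp
    have h1 := hmin c (Finset.mem_erase.2 ⟨hcp, hc⟩)
    have h2 := mul_nonneg (h c hc) (sub_nonneg.2 h1)
    have h3 : (c.2 - p.2) = (c.2 - p.2) / (c.1 - p.1) * (c.1 - p.1) :=
      (div_mul_cancel₀ _ (hd c hc hcp)).symm
    rw [height_lineThrough]
    calc (0 : ℝ) ≤ _ := h2
      _ = (σ * σ) * (τ * ((c.2 - p.2) / (c.1 - p.1) * (c.1 - p.1)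
            - (q.2 - p.2) / (q.1 - p.1) * (c.1 - p.1))) := by ring
      _ = _ := by rw [hσ, ← h3, one_mul]

lemma three_le_card_trivial_sides {P : Finset (ℝ × ℝ)}
    (hx : Set.InjOn Prod.fst (P : Set (ℝ × ℝ))) (hcol : ∀ l, ∃ c ∈ P, height l c ≠ 0) :
    3 ≤ Finset.card {s ∈ lines P ×ˢ (Finset.univ : Finset Bool) |
      sidePart P s = P ∨ sidePart P s = ∅} := by
  obtain ⟨c₀, hc₀, -⟩ := hcol 0
  obtain ⟨p, hp, hpmin⟩ := P.exists_min_image Prod.fst ⟨c₀, hc₀⟩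
  obtain ⟨q, hq, hqmax⟩ := P.exists_max_image Prod.fst ⟨c₀, hc₀⟩
  have hne : ∀ r : ℝ × ℝ, ∃ c ∈ P, c ≠ r := fun r => by
    obtain ⟨c, hc, h⟩ := hcol (0, r.2)
    refine ⟨c, hc, ?_⟩
    rintro rfl
    simp [height] at h
  have hpq : p ≠ q := by
    rintro rfl
    obtain ⟨c, hc, h⟩ := hne p
    exact h (hx hc hp (le_antisymm (hqmax c hc) (hpmin c hc)))
  have hpq1 : p.1 ≠ q.1 := fun e => hpq (hx hp hq e)
  have hlow : ∀ l ∈ lines P, (∀ c ∈ P, 0 ≤ (1 : ℝ) * height l c) →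
      (l, true) ∈ ({s ∈ lines P ×ˢ (Finset.univ : Finset Bool) |
        sidePart P s = P ∨ sidePart P s = ∅} : Finset _) := fun l hl h =>
    Finset.mem_filter.2 ⟨Finset.mk_mem_product hl (Finset.mem_univ _), Or.inl
      (Finset.filter_true_of_mem fun c hc => by simpa using h c hc)⟩
  have hupp : ∀ l ∈ lines P, (∀ c ∈ P, 0 ≤ (-1 : ℝ) * height l c) →
      (l, false) ∈ ({s ∈ lines P ×ˢ (Finset.univ : Finset Bool) |
        sidePart P s = P ∨ sidePart P s = ∅} : Finset _) := fun l hl h =>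
    Finset.mem_filter.2 ⟨Finset.mk_mem_product hl (Finset.mem_univ _), Or.inr
      (Finset.filter_false_of_mem fun c hc => by simpa using h c hc)⟩
  have hpσ : ∀ c ∈ P, 0 ≤ (1 : ℝ) * (c.1 - p.1) := fun c hc => by
    linarith [hpmin c hc]
  have hqσ : ∀ c ∈ P, 0 ≤ (-1 : ℝ) * (c.1 - q.1) := fun c hc => by
    linarith [hqmax c hc]
  obtain ⟨a, ha, hap, has⟩ := exists_support hx hp (hne p) (σ := 1) (τ := 1) (by norm_num) hpσ
  obtain ⟨b, hb, hbp, hbs⟩ := exists_support hx hp (hne p) (σ := 1) (τ := -1) (by norm_num) hpσ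
  obtain ⟨a', ha', haq, has'⟩ := exists_support hx hq (hne q) (σ := -1) (τ := 1) (by norm_num) hqσ
  obtain ⟨b', hb', hbq, hbs'⟩ :=
    exists_support hx hq (hne q) (σ := -1) (τ := -1) (by norm_num) hqσ
  have hor : a ≠ a' ∨ b ≠ b' := by
    by_contra! h
    obtain ⟨rfl, rfl⟩ := h
    have hab : a = b := (eq_lineThrough hpq1 hap haq).trans (eq_lineThrough hpq1 hbp hbq).symm
    subst hab
    obtain ⟨c, hc, h⟩ := hcol a
    exact h (by linarith [has c hc, hbs c hc])
  refine Finset.two_lt_card.2 ?_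
  rcases hor with h | h
  · exact ⟨_, hlow a ha has, _, hlow a' ha' has', _, hupp b hb hbs, by simp [h], by simp, by simp⟩
  · exact ⟨_, hlow a ha has, _, hupp b hb hbs, _, hupp b' hb' hbs', by simp, by simp, by simp [h]⟩

/-- Melchior's inequality for finite sets with distinct abscissae. -/
theorem melchior {P : Finset (ℝ × ℝ)} (hx : Set.InjOn Prod.fst (P : Set (ℝ × ℝ)))
    (hcol : ∀ l, ∃ c ∈ P, height l c ≠ 0) :
    ∑ l ∈ lines P, ((onLine P l).card - 1) + 3 ≤ 2 * (lines P).card := by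
  classical
  choose! Φ hΦ hΦ' using fun z hz => exists_side hx hcol (z := z) hz
  have hsub : ∀ z, upperPart P z ⊆ P := fun z => Finset.filter_subset _ _
  have hinj : Set.InjOn Φ (gaps P : Set _) := by
    intro z hz z' hz' h
    rcases hΦ' z hz with e | e <;> rcases hΦ' z' hz' with e' | e' <;>
      rw [h, e'] at e
    · exact gap_eq_of_upperPart_eq hx hz hz' e.symm
    · exact absurd e.symm (upperPart_ne_compl hcol hz hz')
    · exact absurd e (upperPart_ne_compl hcol hz' hz)
    · refine gap_eq_of_upperPart_eq hx hz hz' ?_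
      rw [← Finset.sdiff_sdiff_eq_self (hsub z), ← e, Finset.sdiff_sdiff_eq_self (hsub z')]
  let T : Finset ((ℝ × ℝ) × Bool) := {s ∈ lines P ×ˢ (Finset.univ : Finset Bool) |
    sidePart P s = P ∨ sidePart P s = ∅}
  have hdisj : Disjoint ((gaps P).image Φ) T := by
    rw [Finset.disjoint_left]
    intro s hs hsT
    obtain ⟨z, hz, rfl⟩ := Finset.mem_image.1 hs
    obtain ⟨-, hp, q, hq, hlt⟩ := mem_gaps.1 hz
    have h1 := left_mem_upperPart hp
    have h2 := right_notMem_upperPart (P := P) hq.2 hlt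
    have h3 := (Finset.mem_filter.1 hsT).2
    rcases hΦ' z hz with e | e <;> rw [e] at h3 <;> rcases h3 with h3 | h3 <;>
      rw [Finset.ext_iff] at h3
    · exact h2 ((h3 q).2 hq.1)
    · exact absurd ((h3 _).1 h1) (Finset.notMem_empty _)
    · exact (Finset.mem_sdiff.1 ((h3 _).2 hp.1)).2 h1
    · exact absurd ((h3 q).1 (Finset.mem_sdiff.2 ⟨hq.1, h2⟩)) (Finset.notMem_empty _)
  have hunion : (gaps P).image Φ ∪ T ⊆ lines P ×ˢ (Finset.univ : Finset Bool) :=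
    Finset.union_subset (Finset.image_subset_iff.2 hΦ) (Finset.filter_subset _ _)
  have hcard := Finset.card_le_card hunion
  rw [Finset.card_union_of_disjoint hdisj, Finset.card_image_of_injOn hinj, card_gaps hx,
    Finset.card_product, Finset.card_univ, Fintype.card_bool] at hcard
  have h3 : 3 ≤ T.card := three_le_card_trivial_sides hx hcol
  omega

/-- At least about half of the determined lines contain at most three points. -/
theorem card_lines_add_three_le {P : Finset (ℝ × ℝ)}
    (hx : Set.InjOn Prod.fst (P : Set (ℝ × ℝ))) (hcol : ∀ l, ∃ c ∈ P, height l c ≠ 0) :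
    (lines P).card + 3 ≤ 2 * (Finset.card {l ∈ lines P | (onLine P l).card = 2} +
      Finset.card {l ∈ lines P | (onLine P l).card = 3}) := by
  have h := melchior hx hcol
  have hle : ∑ l ∈ lines P, 3 ≤ ∑ l ∈ lines P, (((onLine P l).card - 1) +
      2 * ((if (onLine P l).card = 2 then 1 else 0) +
        (if (onLine P l).card = 3 then 1 else 0))) := by
    refine Finset.sum_le_sum fun l hl => ?_
    have := (mem_lines hx).1 hl
    split_ifs <;> omega
  rw [Finset.sum_add_distrib, ← Finset.mul_sum, Finset.sum_add_distrib, ← Finset.card_filter,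
    ← Finset.card_filter, Finset.sum_const, smul_eq_mul] at hle
  omega

/-- The shear `(x, y) ↦ (x + c y, y)`. -/
def shear (c : ℝ) (p : Pt2) : ℝ × ℝ := (p 0 + c * p 1, p 1)

lemma shear_injective (c : ℝ) : Function.Injective (shear c) := by
  intro p q h
  simp only [shear, Prod.mk.injEq] at h
  obtain ⟨h0, h1⟩ := h
  rw [h1] at h0
  ext i
  fin_cases i
  · simpa using h0
  · exact h1

lemma shear_surjective (c : ℝ) : Function.Surjective (shear c) := fun a =>
  ⟨!₂[a.1 - c * a.2, a.2], by simp [shear]⟩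

lemma exists_shear_injOn {S : Set Pt2} (hS : S.Finite) :
    ∃ c : ℝ, Set.InjOn (fun p => (shear c p).1) S := by
  obtain ⟨c, hc⟩ := ((hS.prod hS).image
    (fun z : Pt2 × Pt2 => -(z.1 0 - z.2 0) / (z.1 1 - z.2 1))).exists_notMem
  refine ⟨c, fun p hp q hq h => ?_⟩
  simp only [shear] at h
  by_cases h1 : p 1 = q 1
  · exact shear_injective c (Prod.ext h h1)
  · refine absurd ⟨(p, q), ⟨hp, hq⟩, ?_⟩ hc
    have := sub_ne_zero.2 h1
    simp only
    rw [div_eq_iff this]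
    linarith

/-- The line in the plane whose shear has slope-intercept form `l`. -/
def lineSet (c : ℝ) (l : ℝ × ℝ) : Set Pt2 := {p | height l (shear c p) = 0}

lemma lineSet_injective (c : ℝ) : Function.Injective (lineSet c) := by
  intro l l' h
  have key : ∀ a, height l a = 0 → height l' a = 0 := fun a ha => by
    obtain ⟨p, rfl⟩ := shear_surjective c a
    exact (Set.ext_iff.1 h p).1 ha
  have h0 := key (0, l.2) (by simp [height])
  have h1 := key (1, l.1 + l.2) (by simp [height])
  simp only [height] at h0 h1
  exact Prod.ext (by linarith) (by linarith)

lemma affineSpan_pair_eq_lineSet {c : ℝ} {l : ℝ × ℝ} {p q : Pt2}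
    (h : (shear c p).1 ≠ (shear c q).1) (hp : p ∈ lineSet c l) (hq : q ∈ lineSet c l) :
    (affineSpan ℝ ({p, q} : Set Pt2) : Set Pt2) = lineSet c l := by
  ext r
  simp only [SetLike.mem_coe, mem_affineSpan_pair_iff_exists_lineMap_eq, AffineMap.lineMap_apply]
  simp only [lineSet, Set.mem_ofPred_eq, height, shear] at *
  have h' : q 0 + c * q 1 - (p 0 + c * p 1) ≠ 0 := sub_ne_zero.2 (Ne.symm h)
  constructor
  · rintro ⟨t, rfl⟩
    simp
    linear_combination (1 - t) * hp + t * hq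
  · intro hr
    obtain ⟨t, ht⟩ : ∃ t, r 0 + c * r 1 - (p 0 + c * p 1) =
        t * (q 0 + c * q 1 - (p 0 + c * p 1)) := ⟨_, (div_mul_cancel₀ _ h').symm⟩
    have h1 : r 1 = p 1 + t * (q 1 - p 1) := by
      linear_combination hr - (1 - t) * hp - t * hq + l.1 * ht
    refine ⟨t, ?_⟩
    ext i
    fin_cases i
    · simp; linear_combination c * h1 - ht
    · simp; linear_combination -h1

lemma isLine_lineSet (c : ℝ) (l : ℝ × ℝ) : IsLine (lineSet c l) := by
  obtain ⟨p, hp⟩ := shear_surjective c (0, l.2)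
  obtain ⟨q, hq⟩ := shear_surjective c (1, l.1 + l.2)
  have hpq : (shear c p).1 ≠ (shear c q).1 := by rw [hp, hq]; simp
  refine ⟨p, q, fun e => hpq (by rw [e]), (affineSpan_pair_eq_lineSet hpq ?_ ?_).symm⟩
  · simp [lineSet, hp, height]
  · simp [lineSet, hq, height]

lemma exists_lineSet_eq {c : ℝ} {L : Set Pt2} (hL : IsLine L) {s t : Pt2} (hs : s ∈ L)
    (ht : t ∈ L) (h : (shear c s).1 ≠ (shear c t).1) : ∃ l, lineSet c l = L := by
  obtain ⟨p, q, -, rfl⟩ := hL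
  have hpq : (shear c p).1 ≠ (shear c q).1 := by
    intro e
    have hconst : ∀ r ∈ (affineSpan ℝ ({p, q} : Set Pt2) : Set Pt2),
        (shear c r).1 = (shear c p).1 := by
      intro r hr
      obtain ⟨u, rfl⟩ := mem_affineSpan_pair_iff_exists_lineMap_eq.1 hr
      simp only [shear] at e
      simp [shear, AffineMap.lineMap_apply]
      linear_combination -u * e
    exact h ((hconst s hs).trans (hconst t ht).symm)
  refine ⟨lineThrough (shear c p) (shear c q), (affineSpan_pair_eq_lineSet hpq ?_ ?_).symm⟩
  · simp only [lineSet, Set.mem_ofPred_eq, height_lineThrough]; ring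
  · simp only [lineSet, Set.mem_ofPred_eq, height_lineThrough]
    rw [div_mul_cancel₀ _ (sub_ne_zero.2 hpq.symm)]; ring

lemma ncard_inter_lineSet {S : Set Pt2} (hS : S.Finite) (c : ℝ) (l : ℝ × ℝ) :
    (S ∩ lineSet c l).ncard = (onLine (hS.toFinset.image (shear c)) l).card := by
  rw [← Set.ncard_image_of_injective _ (shear_injective c), ← Set.ncard_coe_finset]
  congr 1
  ext a
  simp only [onLine, lineSet, Finset.coe_filter, Finset.mem_image, Set.Finite.mem_toFinset,
    Set.mem_image, Set.mem_inter_iff, Set.mem_ofPred_eq]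
  constructor
  · rintro ⟨p, ⟨hp, h⟩, rfl⟩; exact ⟨⟨p, hp, rfl⟩, h⟩
  · rintro ⟨⟨p, hp, rfl⟩, h⟩; exact ⟨p, ⟨hp, h⟩, rfl⟩

/-- The lines whose number of points satisfies `Q` correspond to those of the sheared
configuration. -/
lemma ncard_lines {S : Set Pt2} (hS : S.Finite) {c : ℝ}
    (hc : Set.InjOn (fun p => (shear c p).1) S)
    (hx : Set.InjOn Prod.fst ((hS.toFinset.image (shear c) : Finset _) : Set (ℝ × ℝ)))
    (Q : ℕ → Prop) [DecidablePred Q] (hQ : ∀ k, Q k → 2 ≤ k) :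
    {L : Set Pt2 | IsLine L ∧ Q (S ∩ L).ncard}.ncard =
      Finset.card {l ∈ lines (hS.toFinset.image (shear c)) |
        Q (onLine (hS.toFinset.image (shear c)) l).card} := by
  rw [← Set.ncard_coe_finset, ← Set.ncard_image_of_injective _ (lineSet_injective c)]
  congr 1
  ext L
  simp only [Finset.coe_filter, Set.mem_image, Set.mem_ofPred_eq, mem_lines hx]
  constructor
  · rintro ⟨hL, hq⟩
    obtain ⟨s, hs, t, ht, hst⟩ := (Set.one_lt_ncard (hS.inter_of_left L)).1 (hQ _ hq)
    obtain ⟨l, rfl⟩ := exists_lineSet_eq (c := c) hL hs.2 ht.2 fun e => hst (hc hs.1 ht.1 e)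
    rw [ncard_inter_lineSet hS] at hq
    exact ⟨l, ⟨hQ _ hq, hq⟩, rfl⟩
  · rintro ⟨l, ⟨-, hq⟩, rfl⟩
    refine ⟨isLine_lineSet c l, ?_⟩
    rwa [ncard_inter_lineSet hS]

end Melchior

open Melchior in
theorem stmt1 (S : Set Pt2) (hS : S.Finite) (hcol : ¬ Collinear ℝ S) :
    ((lineCount S 2 + lineCount S 3 : ℕ) : ℝ) ≥ (((detLines S).ncard : ℝ) + 3) / 2 := by
  obtain ⟨c, hc⟩ := exists_shear_injOn hS
  have hx : Set.InjOn Prod.fst ((hS.toFinset.image (shear c) : Finset _) : Set (ℝ × ℝ)) := by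
    intro a ha b hb hab
    simp only [Finset.coe_image, Set.Finite.coe_toFinset] at ha hb
    obtain ⟨p, hp, rfl⟩ := ha
    obtain ⟨q, hq, rfl⟩ := hb
    rw [hc hp hq hab]
  have hcol' : ∀ l, ∃ a ∈ hS.toFinset.image (shear c), height l a ≠ 0 := by
    intro l
    by_contra! h
    refine hcol ?_
    obtain ⟨p, q, -, hL⟩ := isLine_lineSet c l
    have hsub : S ⊆ lineSet c l := fun s hs =>
      h _ (Finset.mem_image_of_mem _ (hS.mem_toFinset.2 hs))
    rw [hL] at hsub
    refine Collinear.subset hsub ?_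
    rw [Collinear, ← direction_affineSpan, AffineSubspace.affineSpan_coe, direction_affineSpan]
    exact collinear_pair ℝ p q
  have key := card_lines_add_three_le hx hcol'
  have h2 : lineCount S 2 = _ := ncard_lines hS hc hx (· = 2) (by omega)
  have h3 : lineCount S 3 = _ := ncard_lines hS hc hx (· = 3) (by omega)
  have ht : (detLines S).ncard = _ := ncard_lines hS hc hx (2 ≤ ·) (by omega)
  rw [Finset.filter_true_of_mem fun l hl => (mem_lines hx).1 hl] at ht
  rw [← h2, ← h3, ← ht] at key
  have key' : ((detLines S).ncard : ℝ) + 3 ≤ 2 * ((lineCount S 2 + lineCount S 3 : ℕ) : ℝ) := by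
    exact_mod_cast key
  linarith
end
end

section
/- For any finite set S of points in ℝ², not all collinear, the total number of determined lines t satisfies 3t − 3 ≥ Σ_{k≥2} k·t_k; that is, the number of determined lines is at least one third of the number of incidences between points of S and determined lines (plus one). -/
open Set

noncomputable section

/-- The signed height of `p` in the direction of angle `θ`. -/
def height (p : Pt2) (θ : ℝ) : ℝ := p 0 * Real.cos θ + p 1 * Real.sin θ

/-- The number of points of `P` strictly above level `c` in direction `θ`. -/
def countGT (P : Finset Pt2) (θ c : ℝ) : ℕ := (P.filter fun p => c < height p θ).card

/-- The number of points of `P` at or above level `c` in direction `θ`. -/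
def countGE (P : Finset Pt2) (θ c : ℝ) : ℕ := (P.filter fun p => c ≤ height p θ).card

/-- The directions in which the points of ranks `j` and `j + 1` have the same height. -/
def crossing (P : Finset Pt2) (j : ℕ) : Set ℝ :=
  {θ | ∃ c, countGT P θ c < j ∧ j < countGE P θ c}

/-- The directions in which some level with at least two points is bounded on one side by
the gap between ranks `j` and `j + 1`. -/
def touching (P : Finset Pt2) (j : ℕ) : Set ℝ :=
  {θ | ∃ c, countGT P θ c + 2 ≤ countGE P θ c ∧ (countGT P θ c = j ∨ countGE P θ c = j)}

/-- Every point of `A` is at least as high as every point of `P` outside `A`. -/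
def Separates (P A : Finset Pt2) (θ : ℝ) : Prop :=
  ∀ a ∈ A, ∀ b ∈ P, b ∉ A → height b θ ≤ height a θ

lemma continuous_height (p : Pt2) : Continuous (height p) := by
  unfold height; fun_prop

lemma height_add_pi (p : Pt2) (θ : ℝ) : height p (θ + Real.pi) = -height p θ := by
  simp [height]; ring

lemma height_add_int (p : Pt2) (θ : ℝ) (m : ℤ) :
    height p (θ + m * (2 * Real.pi)) = height p θ := by
  simp [height, Real.cos_add_int_mul_two_pi, Real.sin_add_int_mul_two_pi]

lemma sin_sub_eq_zero {p q : Pt2} (hpq : p ≠ q) {θ φ : ℝ} (h1 : height p θ = height q θ)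
    (h2 : height p φ = height q φ) : Real.sin (θ - φ) = 0 := by
  by_contra hs
  rw [Real.sin_sub] at hs
  unfold height at h1 h2
  apply hpq
  ext i
  fin_cases i
  · apply mul_right_cancel₀ hs
    simp only [Fin.zero_eta]
    linear_combination (-Real.sin φ) * h1 + Real.sin θ * h2
  · apply mul_right_cancel₀ hs
    simp only [Fin.mk_one]
    linear_combination (Real.cos φ) * h1 - Real.cos θ * h2

lemma collinear_of_height_eq {P : Finset Pt2} {θ c : ℝ} (h : ∀ p ∈ P, height p θ = c) :
    Collinear ℝ (P : Set Pt2) := by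
  rw [collinear_iff_exists_forall_eq_smul_vadd]
  refine ⟨!₂[c * Real.cos θ, c * Real.sin θ], !₂[-Real.sin θ, Real.cos θ], fun p hp => ?_⟩
  refine ⟨-p 0 * Real.sin θ + p 1 * Real.cos θ, ?_⟩
  have h1 := h p hp
  unfold height at h1
  have h2 := Real.sin_sq_add_cos_sq θ
  ext i
  fin_cases i
  · simp
    linear_combination (Real.cos θ) * h1 - p 0 * h2
  · simp
    linear_combination (Real.sin θ) * h1 - p 1 * h2

lemma crossing_add_int {P : Finset Pt2} {j : ℕ} {θ : ℝ} (m : ℤ) :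
    θ + m * (2 * Real.pi) ∈ crossing P j ↔ θ ∈ crossing P j := by
  simp [crossing, countGT, countGE, height_add_int]

lemma touching_add_int {P : Finset Pt2} {j : ℕ} {θ : ℝ} (m : ℤ) :
    θ + m * (2 * Real.pi) ∈ touching P j ↔ θ ∈ touching P j := by
  simp [touching, countGT, countGE, height_add_int]

/-- A preconnected set covered by finitely many closed sets, any two of which are disjoint on it,
lies in one of them. -/
lemma IsPreconnected.exists_subset_of_closed_cover {ι : Type*} (s : Finset ι) (U : ι → Set ℝ)
    (hU : ∀ i ∈ s, IsClosed (U i)) {I : Set ℝ} (hI : IsPreconnected I) (hne : I.Nonempty)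
    (hcov : ∀ x ∈ I, ∃ i ∈ s, x ∈ U i)
    (huniq : ∀ x ∈ I, ∀ i ∈ s, ∀ k ∈ s, x ∈ U i → x ∈ U k → i = k) :
    ∃ i ∈ s, closure I ⊆ U i := by
  classical
  obtain ⟨x, hx⟩ := hne
  obtain ⟨i, hi, hxi⟩ := hcov x hx
  refine ⟨i, hi, closure_minimal ?_ (hU i hi)⟩
  intro y hy
  by_contra hyi
  obtain ⟨k, hk, hyk⟩ := hcov y hy
  have hki : k ≠ i := by rintro rfl; exact hyi hyk
  have hcl : IsClosed (⋃ k ∈ s.erase i, U k) :=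
    isClosed_biUnion_finset fun k hk => hU k (Finset.mem_of_mem_erase hk)
  obtain ⟨z, hz, hzi, hz'⟩ := isPreconnected_closed_iff.1 hI (U i) _ (hU i hi) hcl
    (fun z hz => by
      obtain ⟨l, hl, hzl⟩ := hcov z hz
      by_cases hli : l = i
      · left; rwa [← hli]
      · right; exact Set.mem_biUnion (Finset.mem_erase.2 ⟨hli, hl⟩) hzl)
    ⟨x, hx, hxi⟩ ⟨y, hy, Set.mem_biUnion (Finset.mem_erase.2 ⟨hki, hk⟩) hyk⟩
  simp only [Set.mem_iUnion] at hz'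
  obtain ⟨l, hl, hzl⟩ := hz'
  exact (Finset.mem_erase.1 hl).1 (huniq z hz l (Finset.mem_of_mem_erase hl) i hi hzl hzi)

lemma exists_forall_le_of_no_ties {ι : Type*} (A : Finset ι) (hA : A.Nonempty) (f : ι → ℝ → ℝ)
    (hf : ∀ i, Continuous (f i)) {I : Set ℝ} (hI : IsPreconnected I) (hne : I.Nonempty)
    (h : ∀ x ∈ I, ∀ i ∈ A, ∀ k ∈ A, f i x = f k x → (∀ l ∈ A, f i x ≤ f l x) → i = k) :
    ∃ i ∈ A, ∀ x ∈ closure I, ∀ k ∈ A, f i x ≤ f k x := by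
  refine IsPreconnected.exists_subset_of_closed_cover A
    (fun i => {x | ∀ k ∈ A, f i x ≤ f k x}) (fun i _ => ?_) hI hne (fun x _ => ?_)
    (fun x hx i hi k hk h1 h2 => h x hx i hi k hk ((h1 k hk).antisymm (h2 i hi)) h1)
  · simp only [Set.ofPred_forall]
    exact isClosed_biInter fun k _ => isClosed_le (hf i) (hf k)
  · exact A.exists_min_image (fun i => f i x) hA

lemma exists_separates (P : Finset Pt2) (θ : ℝ) {j : ℕ} (hj : j ≤ P.card) :
    ∃ A ∈ P.powersetCard j, Separates P A θ := by
  classical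
  induction j with
  | zero => exact ⟨∅, by simp, by simp [Separates]⟩
  | succ j ih =>
    obtain ⟨A, hA, hs⟩ := ih (by omega)
    rw [Finset.mem_powersetCard] at hA
    have hne : (P \ A).Nonempty := by
      rw [← Finset.card_pos, Finset.card_sdiff_of_subset hA.1]; omega
    obtain ⟨b, hb, hmax⟩ := (P \ A).exists_max_image (fun p => height p θ) hne
    rw [Finset.mem_sdiff] at hb
    refine ⟨insert b A, ?_, ?_⟩
    · rw [Finset.mem_powersetCard, Finset.card_insert_of_notMem hb.2, hA.2]
      exact ⟨Finset.insert_subset hb.1 hA.1, rfl⟩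
    · intro a ha x hx hxA
      rw [Finset.mem_insert, not_or] at hxA
      rcases Finset.mem_insert.1 ha with rfl | ha
      · exact hmax x (Finset.mem_sdiff.2 ⟨hx, hxA.2⟩)
      · exact hs a ha x hx hxA.2

lemma isClosed_separates (P A : Finset Pt2) : IsClosed {θ | Separates P A θ} := by
  simp only [Separates, Set.ofPred_forall]
  exact isClosed_biInter fun a _ => isClosed_biInter fun b _ => isClosed_iInter fun _ =>
    isClosed_le (continuous_height b) (continuous_height a)

lemma Separates.mem_crossing {P A : Finset Pt2} {θ : ℝ} (hs : Separates P A θ) (hAP : A ⊆ P)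
    {a b : Pt2} (ha : a ∈ A) (hb : b ∈ P) (hbA : b ∉ A) (hab : height a θ = height b θ) :
    θ ∈ crossing P A.card := by
  classical
  refine ⟨height a θ, Finset.card_lt_card ?_, Finset.card_lt_card ?_⟩
  · rw [Finset.ssubset_iff_of_subset]
    · exact ⟨a, ha, by simp⟩
    · intro x hx
      rw [Finset.mem_filter] at hx
      by_contra hxA
      exact (hs a ha x hx.1 hxA).not_gt hx.2
  · rw [Finset.ssubset_iff_of_subset]
    · exact ⟨b, by simp [hb, hab], hbA⟩
    · intro x hx
      rw [Finset.mem_filter]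
      exact ⟨hAP hx, hab ▸ hs x hx b hb hbA⟩

lemma exists_separates_on {P : Finset Pt2} {j : ℕ} (hj : j ≤ P.card) {I : Set ℝ}
    (hI : IsPreconnected I) (hne : I.Nonempty) (hC : ∀ x ∈ I, x ∉ crossing P j) :
    ∃ A ∈ P.powersetCard j, ∀ x ∈ closure I, Separates P A x := by
  refine IsPreconnected.exists_subset_of_closed_cover (P.powersetCard j)
    (fun A => {θ | Separates P A θ}) (fun A _ => isClosed_separates P A) hI hne
    (fun x _ => exists_separates P x hj) ?_
  intro x hx A hA B hB hsA hsB
  rw [Finset.mem_powersetCard] at hA hB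
  by_contra hAB
  obtain ⟨a, ha, haB⟩ : ∃ a ∈ A, a ∉ B := by
    by_contra! h
    exact hAB (Finset.eq_of_subset_of_card_le h (by omega))
  obtain ⟨b, hb, hbA⟩ : ∃ b ∈ B, b ∉ A := by
    by_contra! h
    exact hAB (Finset.eq_of_subset_of_card_le h (by omega)).symm
  refine hC x hx (hA.2 ▸ hsA.mem_crossing hA.1 ha (hB.1 hb) hbA ?_)
  exact (hsB b hb a (hA.1 ha) haB).antisymm (hsA a ha b (hB.1 hb) hbA)

lemma Separates.exists_min {P A : Finset Pt2} (hAP : A ⊆ P) (hA : A.Nonempty) {I : Set ℝ}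
    (hI : IsPreconnected I) (hne : I.Nonempty) (hC : ∀ x ∈ I, x ∉ crossing P A.card)
    (hT : ∀ x ∈ I, x ∉ touching P A.card) (hs : ∀ x ∈ I, Separates P A x) :
    ∃ p ∈ A, ∀ x ∈ closure I, ∀ a ∈ A, height p x ≤ height a x := by
  classical
  refine exists_forall_le_of_no_ties A hA height continuous_height hI hne ?_
  intro x hx p hp q hq hpq hmin
  by_contra hne
  have hge : P.filter (fun r => height p x ≤ height r x) = A := by
    ext r
    rw [Finset.mem_filter]
    refine ⟨fun hr => ?_, fun hr => ⟨hAP hr, hmin r hr⟩⟩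
    by_contra hrA
    exact hC x hx ((hs x hx).mem_crossing hAP hp hr.1 hrA
      (hr.2.antisymm (hs x hx p hp r hr.1 hrA)))
  refine hT x hx ⟨height p x, ?_, Or.inr (congrArg Finset.card hge)⟩
  have hsub : P.filter (fun r => height p x < height r x) ⊆ (A.erase p).erase q := by
    intro r hr
    rw [Finset.mem_filter] at hr
    have hrA : r ∈ A := hge ▸ Finset.mem_filter.2 ⟨hr.1, hr.2.le⟩
    refine Finset.mem_erase.2 ⟨?_, Finset.mem_erase.2 ⟨?_, hrA⟩⟩
    · rintro rfl; exact hr.2.ne hpq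
    · rintro rfl; exact hr.2.ne rfl
  have h1 := Finset.card_le_card hsub
  have h2 : 1 < A.card := Finset.one_lt_card.2 ⟨p, hp, q, hq, hne⟩
  rw [Finset.card_erase_of_mem (Finset.mem_erase.2 ⟨Ne.symm hne, hq⟩),
    Finset.card_erase_of_mem hp] at h1
  unfold countGT countGE
  rw [hge]
  omega

lemma Separates.exists_max {P A : Finset Pt2} (hAP : A ⊂ P) {I : Set ℝ}
    (hI : IsPreconnected I) (hne : I.Nonempty) (hC : ∀ x ∈ I, x ∉ crossing P A.card)
    (hT : ∀ x ∈ I, x ∉ touching P A.card) (hs : ∀ x ∈ I, Separates P A x) :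
    ∃ q ∈ P, q ∉ A ∧ ∀ x ∈ closure I, ∀ b ∈ P, b ∉ A → height b x ≤ height q x := by
  classical
  suffices h : ∃ q ∈ P \ A, ∀ x ∈ closure I, ∀ b ∈ P \ A, -height q x ≤ -height b x by
    obtain ⟨q, hq, h⟩ := h
    rw [Finset.mem_sdiff] at hq
    exact ⟨q, hq.1, hq.2, fun x hx b hb hbA =>
      neg_le_neg_iff.1 (h x hx b (Finset.mem_sdiff.2 ⟨hb, hbA⟩))⟩
  refine exists_forall_le_of_no_ties (P \ A) (Finset.sdiff_nonempty.2 hAP.2)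
    (fun p x => -height p x) (fun p => (continuous_height p).neg) hI hne ?_
  intro x hx p hp q hq hpq hmax
  by_contra hne
  rw [neg_inj] at hpq
  simp only [neg_le_neg_iff, Finset.mem_sdiff] at hmax hp hq
  have hgt : P.filter (fun r => height p x < height r x) = A := by
    ext r
    rw [Finset.mem_filter]
    refine ⟨fun hr => ?_, fun hr => ⟨hAP.1 hr, ?_⟩⟩
    · by_contra hrA
      exact (hmax r ⟨hr.1, hrA⟩).not_gt hr.2
    · refine lt_of_le_of_ne (hs x hx r hr p hp.1 hp.2) fun h => ?_
      exact hC x hx ((hs x hx).mem_crossing hAP.1 hr hp.1 hp.2 h.symm)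
  refine hT x hx ⟨height p x, ?_, Or.inl (congrArg Finset.card hgt)⟩
  have hsub : insert p (insert q A) ⊆ P.filter (fun r => height p x ≤ height r x) := by
    intro r hr
    rw [Finset.mem_filter]
    rcases Finset.mem_insert.1 hr with rfl | hr
    · exact ⟨hp.1, le_rfl⟩
    rcases Finset.mem_insert.1 hr with rfl | hr
    · exact ⟨hq.1, hpq.le⟩
    · exact ⟨hAP.1 hr, hs x hx r hr p hp.1 hp.2⟩
  have h1 := Finset.card_le_card hsub
  rw [Finset.card_insert_of_notMem (by simp [hne, hp.2]),
    Finset.card_insert_of_notMem hq.2] at h1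
  unfold countGT countGE
  rw [hgt]
  omega

lemma exists_height_le_of_countGT_lt {P A : Finset Pt2} {θ c : ℝ} (hAP : A ⊆ P)
    (h : countGT P θ c < A.card) : ∃ a ∈ A, height a θ ≤ c := by
  by_contra! hcon
  refine h.not_ge (Finset.card_le_card fun a ha => ?_)
  exact Finset.mem_filter.2 ⟨hAP ha, hcon a ha⟩

lemma exists_le_height_of_lt_countGE {P A : Finset Pt2} {θ c : ℝ}
    (h : A.card < countGE P θ c) : ∃ b ∈ P, b ∉ A ∧ c ≤ height b θ := by
  by_contra! hcon
  refine h.not_ge (Finset.card_le_card fun b hb => ?_)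
  rw [Finset.mem_filter] at hb
  by_contra hbA
  exact (hcon b hb.1 hbA).not_ge hb.2

lemma height_eq_of_mem_crossing {P A : Finset Pt2} {θ : ℝ} (hAP : A ⊆ P)
    (hθ : θ ∈ crossing P A.card) (hs : Separates P A θ) {p q : Pt2} (hp : p ∈ A) (hq : q ∈ P)
    (hqA : q ∉ A) (hmin : ∀ a ∈ A, height p θ ≤ height a θ)
    (hmax : ∀ b ∈ P, b ∉ A → height b θ ≤ height q θ) : height p θ = height q θ := by
  obtain ⟨c, h1, h2⟩ := hθ
  obtain ⟨a, ha, hac⟩ := exists_height_le_of_countGT_lt hAP h1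
  obtain ⟨b, hb, hbA, hbc⟩ := exists_le_height_of_lt_countGE h2
  exact le_antisymm ((hmin a ha).trans (hac.trans (hbc.trans (hmax b hb hbA)))) (hs p hp q hq hqA)

lemma height_eq_of_le_of_le {p q : Pt2} {θ : ℝ} (h1 : height p θ ≤ height q θ)
    (h2 : height p (θ + Real.pi) ≤ height q (θ + Real.pi)) : height p θ = height q θ := by
  rw [height_add_pi, height_add_pi] at h2
  linarith

lemma exists_touching_between {P : Finset Pt2} (hP : ¬ Collinear ℝ (P : Set Pt2)) {j : ℕ}
    (hj0 : 0 < j) (hj : j < P.card) {θ φ : ℝ} (hlt : θ < φ) (hθ : θ ∈ crossing P j)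
    (hφ : φ ∈ crossing P j) (hC : ∀ x ∈ Ioo θ φ, x ∉ crossing P j) :
    ∃ x ∈ Ioo θ φ, x ∈ touching P j := by
  by_contra! hT
  have hI : IsPreconnected (Ioo θ φ) := isPreconnected_Ioo
  have hne : (Ioo θ φ).Nonempty := nonempty_Ioo.2 hlt
  have hcl : closure (Ioo θ φ) = Icc θ φ := closure_Ioo hlt.ne
  obtain ⟨A, hA, hs⟩ := exists_separates_on hj.le hI hne hC
  obtain ⟨hAP, rfl⟩ := Finset.mem_powersetCard.1 hA
  have hss : A ⊂ P := ⟨hAP, fun h => hj.not_ge (Finset.card_le_card h)⟩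
  have hs' : ∀ x ∈ Ioo θ φ, Separates P A x := fun x hx => hs x (subset_closure hx)
  obtain ⟨p, hp, hmin⟩ := Separates.exists_min hAP (Finset.card_pos.1 hj0) hI hne hC hT hs'
  obtain ⟨q, hq, hqA, hmax⟩ := Separates.exists_max hss hI hne hC hT hs'
  rw [hcl] at hs hmin hmax
  have hθ' : θ ∈ Icc θ φ := left_mem_Icc.2 hlt.le
  have hφ' : φ ∈ Icc θ φ := right_mem_Icc.2 hlt.le
  have e1 := height_eq_of_mem_crossing hAP hθ (hs θ hθ') hp hq hqA (hmin θ hθ') (hmax θ hθ')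
  have e2 := height_eq_of_mem_crossing hAP hφ (hs φ hφ') hp hq hqA (hmin φ hφ') (hmax φ hφ')
  have hpq : p ≠ q := by rintro rfl; exact hqA hp
  have hsin := sin_sub_eq_zero hpq e2 e1
  have hle : θ + Real.pi ≤ φ := by
    by_contra! h
    exact (Real.sin_pos_of_pos_of_lt_pi (by linarith) (by linarith)).ne' hsin
  have hm : θ + Real.pi ∈ Icc θ φ := ⟨by linarith [Real.pi_pos], hle⟩
  apply hP
  apply collinear_of_height_eq (θ := θ) (c := height p θ)
  intro x hx
  by_cases hxA : x ∈ A
  · exact (height_eq_of_le_of_le (hmin θ hθ' x hxA) (hmin _ hm x hxA)).symm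
  · rw [e1]
    exact height_eq_of_le_of_le (hmax θ hθ' x hx hxA) (hmax _ hm x hx hxA)

lemma exists_touching_zero {P : Finset Pt2} (hP : ¬ Collinear ℝ (P : Set Pt2)) (θ : ℝ) :
    ∃ x ∈ Ioo θ (θ + Real.pi), x ∈ touching P 0 := by
  by_contra! hT
  have hlt : θ < θ + Real.pi := by linarith [Real.pi_pos]
  have hne : P.Nonempty := by
    rw [Finset.nonempty_iff_ne_empty]; rintro rfl; exact hP (by simpa using collinear_empty ℝ Pt2)
  obtain ⟨q, hq, -, hmax⟩ := Separates.exists_max (P := P) (A := ∅)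
    (Finset.empty_ssubset.2 hne) (isPreconnected_Ioo (a := θ) (b := θ + Real.pi))
    (nonempty_Ioo.2 hlt) (by simp [crossing]) (by simpa using hT) (by simp [Separates])
  rw [closure_Ioo hlt.ne] at hmax
  apply hP
  apply collinear_of_height_eq (θ := θ) (c := height q θ)
  exact fun x hx => height_eq_of_le_of_le (hmax _ (left_mem_Icc.2 hlt.le) x hx (by simp))
    (hmax _ (right_mem_Icc.2 hlt.le) x hx (by simp))

lemma exists_touching_card {P : Finset Pt2} (hP : ¬ Collinear ℝ (P : Set Pt2)) (θ : ℝ) :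
    ∃ x ∈ Ioo θ (θ + Real.pi), x ∈ touching P P.card := by
  by_contra! hT
  have hlt : θ < θ + Real.pi := by linarith [Real.pi_pos]
  have hne : P.Nonempty := by
    rw [Finset.nonempty_iff_ne_empty]; rintro rfl; exact hP (by simpa using collinear_empty ℝ Pt2)
  obtain ⟨p, hp, hmin⟩ := Separates.exists_min (P := P) (A := P) subset_rfl hne
    (isPreconnected_Ioo (a := θ) (b := θ + Real.pi)) (nonempty_Ioo.2 hlt)
    (by
      rintro x - ⟨c, -, h⟩
      exact h.not_ge (Finset.card_filter_le _ _))
    hT (fun x _ a _ b hb hbP => absurd hb hbP)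
  rw [closure_Ioo hlt.ne] at hmin
  apply hP
  apply collinear_of_height_eq (θ := θ) (c := height p θ)
  exact fun x hx => (height_eq_of_le_of_le (hmin _ (left_mem_Icc.2 hlt.le) x hx)
    (hmin _ (right_mem_Icc.2 hlt.le) x hx)).symm

lemma finite_height_eq {p q : Pt2} (hpq : p ≠ q) (a b : ℝ) :
    {θ ∈ Icc a b | height p θ = height q θ}.Finite := by
  rcases Set.eq_empty_or_nonempty {θ ∈ Icc a b | height p θ = height q θ} with h | ⟨φ, hφ⟩
  · rw [h]; exact Set.finite_empty
  · refine ((Set.finite_Icc ⌊(a - φ) / Real.pi⌋ ⌈(b - φ) / Real.pi⌉).image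
      (fun m : ℤ => φ + m * Real.pi)).subset ?_
    rintro θ ⟨hθ, he⟩
    obtain ⟨m, hm⟩ := Real.sin_eq_zero_iff.1 (sin_sub_eq_zero hpq he hφ.2)
    have hm' : (m : ℝ) = (θ - φ) / Real.pi := by field_simp; linarith
    refine ⟨m, ⟨?_, ?_⟩, by simp only; linarith⟩
    · have : (⌊(a - φ) / Real.pi⌋ : ℝ) ≤ m := by
        refine (Int.floor_le _).trans ?_
        rw [hm']
        gcongr
        exact hθ.1
      exact_mod_cast this
    · have : (m : ℝ) ≤ ⌈(b - φ) / Real.pi⌉ := by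
        refine le_trans ?_ (Int.le_ceil _)
        rw [hm']
        gcongr
        exact hθ.2
      exact_mod_cast this

lemma countGT_add_card_level (P : Finset Pt2) (θ c : ℝ) :
    countGT P θ c + (P.filter fun p => height p θ = c).card = countGE P θ c := by
  classical
  unfold countGT countGE
  rw [← Finset.card_union_of_disjoint]
  · congr 1
    ext p
    simp only [Finset.mem_union, Finset.mem_filter, le_iff_lt_or_eq, eq_comm (a := c)]
    tauto
  · rw [Finset.disjoint_filter]
    intro p _ h1 h2
    exact h1.ne' h2

lemma exists_ne_height_eq {P : Finset Pt2} {θ c : ℝ} (h : countGT P θ c + 2 ≤ countGE P θ c) :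
    ∃ p ∈ P, ∃ q ∈ P, p ≠ q ∧ height p θ = c ∧ height q θ = c := by
  rw [← countGT_add_card_level] at h
  obtain ⟨p, hp, q, hq, hpq⟩ := Finset.one_lt_card.1
    (show 1 < (P.filter fun p => height p θ = c).card by omega)
  rw [Finset.mem_filter] at hp hq
  exact ⟨p, hp.1, q, hq.1, hpq, hp.2, hq.2⟩

lemma finite_ties (P : Finset Pt2) (a b : ℝ) :
    {θ ∈ Icc a b | ∃ p ∈ P, ∃ q ∈ P, p ≠ q ∧ height p θ = height q θ}.Finite := by
  refine (P.finite_toSet.biUnion fun p _ => P.finite_toSet.biUnion fun q _ =>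
    Set.finite_iUnion fun hpq : p ≠ q => finite_height_eq hpq a b).subset ?_
  rintro θ ⟨hθ, p, hp, q, hq, hpq, he⟩
  simp only [Set.mem_iUnion]
  exact ⟨p, hp, q, hq, hpq, hθ, he⟩

lemma finite_crossing (P : Finset Pt2) (j : ℕ) (a b : ℝ) : (crossing P j ∩ Icc a b).Finite := by
  refine (finite_ties P a b).subset ?_
  rintro θ ⟨⟨c, h1, h2⟩, hθ⟩
  obtain ⟨p, hp, q, hq, hpq, e1, e2⟩ := exists_ne_height_eq (P := P) (θ := θ) (c := c) (by omega)
  exact ⟨hθ, p, hp, q, hq, hpq, e1.trans e2.symm⟩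

lemma exists_touching_after {P : Finset Pt2} (hP : ¬ Collinear ℝ (P : Set Pt2)) {j : ℕ}
    (hj0 : 0 < j) (hj : j < P.card) {θ : ℝ} (hθ : θ ∈ crossing P j) :
    ∃ x ∈ touching P j, θ < x ∧ ∀ y ∈ crossing P j, θ < y → x < y := by
  have hpi := Real.two_pi_pos
  have hfin : (crossing P j ∩ Ioc θ (θ + 2 * Real.pi)).Finite :=
    (finite_crossing P j θ (θ + 2 * Real.pi)).subset
      (inter_subset_inter_right _ Ioc_subset_Icc_self)
  have hmem : θ + 2 * Real.pi ∈ crossing P j := by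
    simpa using (crossing_add_int (P := P) (j := j) (θ := θ) 1).2 hθ
  obtain ⟨φ, ⟨hφ, hφI⟩, hmin⟩ := Set.exists_min_image _ id hfin
    ⟨θ + 2 * Real.pi, hmem, by linarith, le_rfl⟩
  have hnext : ∀ y ∈ crossing P j, θ < y → φ ≤ y := by
    intro y hy hlt
    by_cases hle : y ≤ θ + 2 * Real.pi
    · exact hmin y ⟨hy, hlt, hle⟩
    · exact hφI.2.trans (not_le.1 hle).le
  obtain ⟨x, hx, hxT⟩ := exists_touching_between hP hj0 hj hφI.1 hθ hφ
    fun x hx hxC => (hnext x hxC hx.1).not_gt hx.2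
  exact ⟨x, hxT, hx.1, fun y hy hlt => hx.2.trans_le (hnext y hy hlt)⟩

lemma ncard_le_of_interlacing {C T : Set ℝ}
    (hC : ∀ x (m : ℤ), x + m * (2 * Real.pi) ∈ C ↔ x ∈ C)
    (hT : ∀ x (m : ℤ), x + m * (2 * Real.pi) ∈ T ↔ x ∈ T)
    (hfin : (T ∩ Ico 0 (2 * Real.pi)).Finite)
    (h : ∀ c ∈ C, ∃ τ ∈ T, c < τ ∧ ∀ y ∈ C, c < y → τ < y) :
    (C ∩ Ico 0 (2 * Real.pi)).ncard ≤ (T ∩ Ico 0 (2 * Real.pi)).ncard := by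
  choose! f hfT hlt hf using h
  have hmod : ∀ x, ∃ m : ℤ, toIcoMod Real.two_pi_pos 0 x = x + m * (2 * Real.pi) := fun x =>
    ⟨-toIcoDiv Real.two_pi_pos 0 x, by
      rw [toIcoMod]; simp [sub_eq_add_neg]⟩
  refine Set.ncard_le_ncard_of_injOn (fun c => toIcoMod Real.two_pi_pos 0 (f c)) ?_ ?_ hfin
  · intro c hc
    refine ⟨?_, by simpa using toIcoMod_mem_Ico Real.two_pi_pos 0 (f c)⟩
    obtain ⟨m, hm⟩ := hmod (f c)
    simp only [hm, hT]
    exact hfT c hc.1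
  · rintro c ⟨hc, hcI⟩ d ⟨hd, hdI⟩ hcd
    obtain ⟨m, hm⟩ := hmod (f c)
    obtain ⟨k, hk⟩ := hmod (f d)
    simp only [hm, hk] at hcd
    have h1 : f c = f d + ((k - m : ℤ) : ℝ) * (2 * Real.pi) := by push_cast; linarith
    have h2 : f d = f c + ((m - k : ℤ) : ℝ) * (2 * Real.pi) := by push_cast; linarith
    have hle : ¬ c < d + ((k - m : ℤ) : ℝ) * (2 * Real.pi) := fun hcon => by
      linarith [hf c hc _ ((hC d (k - m)).2 hd) hcon, hlt d hd]
    have hge : ¬ d < c + ((m - k : ℤ) : ℝ) * (2 * Real.pi) := fun hcon => by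
      linarith [hf d hd _ ((hC c (m - k)).2 hc) hcon, hlt c hc]
    have heq : c = d + ((k - m : ℤ) : ℝ) * (2 * Real.pi) := by
      push_cast at hle hge ⊢
      linarith
    have hpi := Real.two_pi_pos
    have hkm : k - m = 0 := by
      rw [← Int.abs_lt_one_iff, abs_lt]
      constructor
      · have : (-1 : ℝ) < ((k - m : ℤ) : ℝ) := by
          nlinarith [hcI.1, hdI.2]
        exact_mod_cast this
      · have : ((k - m : ℤ) : ℝ) < 1 := by
          nlinarith [hcI.2, hdI.1]
        exact_mod_cast this
    rw [hkm] at heq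
    simpa using heq

lemma three_le_ncard {T : Set ℝ} (hT : ∀ x (m : ℤ), x + m * (2 * Real.pi) ∈ T ↔ x ∈ T)
    (hfin : (T ∩ Ico 0 (2 * Real.pi)).Finite)
    (h : ∀ θ, ∃ x ∈ Ioo θ (θ + Real.pi), x ∈ T) : 3 ≤ (T ∩ Ico 0 (2 * Real.pi)).ncard := by
  obtain ⟨x, hx, hxT⟩ := h 0
  obtain ⟨y, hy, hyT⟩ := h x
  obtain ⟨z, hz, hzT⟩ := h y
  simp only [mem_Ioo] at hx hy hz
  suffices ∃ w ∈ T ∩ Ico 0 (2 * Real.pi), w ≠ x ∧ w ≠ y by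
    obtain ⟨w, hw, hwx, hwy⟩ := this
    have : ({w, x, y} : Set ℝ) ⊆ T ∩ Ico 0 (2 * Real.pi) := by
      rintro v (rfl | rfl | rfl)
      · exact hw
      · exact ⟨hxT, by linarith, by linarith⟩
      · exact ⟨hyT, by linarith, by linarith⟩
    calc 3 = ({w, x, y} : Set ℝ).ncard := by
          rw [Set.ncard_eq_three.2 ⟨w, x, y, hwx, hwy, by linarith, rfl⟩]
      _ ≤ _ := Set.ncard_le_ncard this hfin
  by_cases hz2 : z < 2 * Real.pi
  · exact ⟨z, ⟨hzT, by linarith, hz2⟩, by linarith, by linarith⟩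
  · refine ⟨z + ((-1 : ℤ) : ℝ) * (2 * Real.pi), ⟨(hT z (-1)).2 hzT, ?_, ?_⟩, ?_, ?_⟩
    · push_cast; linarith
    · push_cast; linarith
    · refine ne_of_lt ?_; push_cast; linarith
    · refine ne_of_lt ?_; push_cast; linarith

lemma finite_events (P : Finset Pt2) :
    {v : ℝ × ℝ | v.1 ∈ Ico 0 (2 * Real.pi) ∧
      countGT P v.1 v.2 + 2 ≤ countGE P v.1 v.2}.Finite := by
  refine (((finite_ties P 0 (2 * Real.pi)).prod P.finite_toSet).image
    (fun x : ℝ × Pt2 => (x.1, height x.2 x.1))).subset ?_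
  rintro ⟨θ, c⟩ ⟨hθ, h⟩
  obtain ⟨p, hp, q, hq, hpq, e1, e2⟩ := exists_ne_height_eq h
  exact ⟨(θ, p), ⟨⟨Ico_subset_Icc_self hθ, p, hp, q, hq, hpq, e1.trans e2.symm⟩, hp⟩, by simp [e1]⟩

/-- The pairs (direction, level) within one turn such that the level contains at least two points
of `P`; every line determined by `P` occurs twice. -/
def events (P : Finset Pt2) : Finset (ℝ × ℝ) := (finite_events P).toFinset

lemma mem_events {P : Finset Pt2} {v : ℝ × ℝ} : v ∈ events P ↔
    v.1 ∈ Ico 0 (2 * Real.pi) ∧ countGT P v.1 v.2 + 2 ≤ countGE P v.1 v.2 := by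
  simp [events]

lemma countGE_le_countGT {P : Finset Pt2} {θ c d : ℝ} (h : c < d) :
    countGE P θ d ≤ countGT P θ c :=
  Finset.card_le_card (Finset.monotone_filter_right P fun _ _ hp => h.trans_le hp)

lemma card_crossing_events_le (P : Finset Pt2) (j : ℕ) :
    ((events P).filter fun v => countGT P v.1 v.2 < j ∧ j < countGE P v.1 v.2).card ≤
      (crossing P j ∩ Ico 0 (2 * Real.pi)).ncard := by
  rw [← Set.ncard_coe_finset]
  refine Set.ncard_le_ncard_of_injOn Prod.fst ?_ ?_
    ((finite_crossing P j 0 (2 * Real.pi)).subset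
      (inter_subset_inter_right _ Ico_subset_Icc_self))
  · intro v hv
    rw [Finset.mem_coe, Finset.mem_filter, mem_events] at hv
    exact ⟨⟨v.2, hv.2⟩, hv.1.1⟩
  · rintro ⟨θ, c⟩ hv ⟨φ, d⟩ hw rfl
    rw [Finset.mem_coe, Finset.mem_filter] at hv hw
    obtain ⟨-, h1, h2⟩ := hv
    obtain ⟨-, h3, h4⟩ := hw
    simp only at h1 h2 h3 h4
    rcases lt_trichotomy c d with h | rfl | h
    · have := countGE_le_countGT (P := P) (θ := θ) h
      omega
    · rfl
    · have := countGE_le_countGT (P := P) (θ := θ) h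
      omega

lemma touching_subset_image_events (P : Finset Pt2) (j : ℕ) :
    touching P j ∩ Ico 0 (2 * Real.pi) ⊆
      Set.image Prod.fst (((events P).filter fun v =>
        countGT P v.1 v.2 = j ∨ countGE P v.1 v.2 = j : Finset (ℝ × ℝ)) : Set (ℝ × ℝ)) := by
  rintro θ ⟨⟨c, h1, h2⟩, hθ⟩
  refine ⟨(θ, c), ?_, rfl⟩
  rw [Finset.mem_coe, Finset.mem_filter, mem_events]
  exact ⟨⟨hθ, h1⟩, h2⟩

lemma finite_touching (P : Finset Pt2) (j : ℕ) : (touching P j ∩ Ico 0 (2 * Real.pi)).Finite :=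
  ((Finset.finite_toSet _).image _).subset (touching_subset_image_events P j)

lemma ncard_touching_le (P : Finset Pt2) (j : ℕ) :
    (touching P j ∩ Ico 0 (2 * Real.pi)).ncard ≤
      ((events P).filter fun v => countGT P v.1 v.2 = j ∨ countGE P v.1 v.2 = j).card := by
  refine (Set.ncard_le_ncard (touching_subset_image_events P j)
    ((Finset.finite_toSet _).image _)).trans ?_
  rw [← Set.ncard_coe_finset]
  exact Set.ncard_image_le (Finset.finite_toSet _)

lemma countGE_le_card (P : Finset Pt2) (θ c : ℝ) : countGE P θ c ≤ P.card :=
  Finset.card_filter_le _ _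

lemma sum_events_le {P : Finset Pt2} (hP : ¬ Collinear ℝ (P : Set Pt2)) :
    ∑ v ∈ events P, (countGE P v.1 v.2 - countGT P v.1 v.2 - 1) + 6 ≤ 2 * (events P).card := by
  classical
  have hC : ∑ v ∈ events P, (countGE P v.1 v.2 - countGT P v.1 v.2 - 1) =
      ∑ j ∈ Finset.range (P.card + 1),
        ((events P).filter fun v => countGT P v.1 v.2 < j ∧ j < countGE P v.1 v.2).card := by
    simp_rw [Finset.card_filter]
    rw [Finset.sum_comm]
    refine Finset.sum_congr rfl fun v _ => ?_
    rw [← Finset.card_filter, ← Nat.card_Ioo]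
    congr 1
    ext j
    have := countGE_le_card P v.1 v.2
    simp only [Finset.mem_Ioo, Finset.mem_filter, Finset.mem_range]
    omega
  have hT : 2 * (events P).card = ∑ j ∈ Finset.range (P.card + 1),
      ((events P).filter fun v => countGT P v.1 v.2 = j ∨ countGE P v.1 v.2 = j).card := by
    simp_rw [Finset.card_filter]
    rw [Finset.sum_comm, mul_comm, ← smul_eq_mul, ← Finset.sum_const]
    refine Finset.sum_congr rfl fun v hv => ?_
    have h2 := (mem_events.1 hv).2
    rw [← Finset.card_filter, ← Finset.card_pair (show countGT P v.1 v.2 ≠ countGE P v.1 v.2 by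
      omega)]
    congr 1
    ext j
    have := countGE_le_card P v.1 v.2
    simp only [Finset.mem_insert, Finset.mem_singleton, Finset.mem_filter, Finset.mem_range]
    omega
  have hend : ∀ j, (∀ θ, ∃ x ∈ Ioo θ (θ + Real.pi), x ∈ touching P j) → 3 ≤
      ((events P).filter fun v => countGT P v.1 v.2 = j ∨ countGE P v.1 v.2 = j).card :=
    fun j h => (three_le_ncard (fun _ m => touching_add_int m) (finite_touching P j) h).trans
      (ncard_touching_le P j)
  have h0 := hend 0 (exists_touching_zero hP)
  have hn := hend P.card (exists_touching_card hP)
  have hmid : ∀ j, 0 < j → j < P.card →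
      ((events P).filter fun v => countGT P v.1 v.2 < j ∧ j < countGE P v.1 v.2).card ≤
      ((events P).filter fun v => countGT P v.1 v.2 = j ∨ countGE P v.1 v.2 = j).card :=
    fun j hj0 hj => (card_crossing_events_le P j).trans
      ((ncard_le_of_interlacing (fun _ m => crossing_add_int m) (fun _ m => touching_add_int m)
        (finite_touching P j) fun _ hc => exists_touching_after hP hj0 hj hc).trans
      (ncard_touching_le P j))
  have hc0 : ((events P).filter fun v =>
      countGT P v.1 v.2 < 0 ∧ 0 < countGE P v.1 v.2).card = 0 := by
    simp
  have hcn : ((events P).filter fun v =>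
      countGT P v.1 v.2 < P.card ∧ P.card < countGE P v.1 v.2).card = 0 := by
    rw [Finset.card_eq_zero, Finset.filter_eq_empty_iff]
    rintro v - ⟨-, h⟩
    exact h.not_ge (countGE_le_card P v.1 v.2)
  rw [hC, hT]
  obtain ⟨m, hm⟩ : ∃ m, P.card = m + 1 := by
    refine Nat.exists_eq_succ_of_ne_zero fun h => hP ?_
    rw [Finset.card_eq_zero.1 h]
    simpa using collinear_empty ℝ Pt2
  rw [hm] at hmid hn hcn ⊢
  rw [Finset.sum_range_succ _ (m + 1), Finset.sum_range_succ _ (m + 1),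
    Finset.sum_range_succ' _ m, Finset.sum_range_succ' _ m, hc0, hcn]
  have := Finset.sum_le_sum fun j (hj : j ∈ Finset.range m) =>
    hmid (j + 1) (by omega) (by rw [Finset.mem_range] at hj; omega)
  omega

/-- The line at level `c` orthogonal to the direction of angle `θ`. -/
def levelLine (θ c : ℝ) : Set Pt2 := {p | height p θ = c}

lemma affineSpan_pair_eq_levelLine {p q : Pt2} (hpq : p ≠ q) {θ c : ℝ} (hp : height p θ = c)
    (hq : height q θ = c) : (affineSpan ℝ ({p, q} : Set Pt2) : Set Pt2) = levelLine θ c := by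
  ext x
  rw [SetLike.mem_coe, mem_affineSpan_pair_iff_exists_lineMap_eq]
  constructor
  · rintro ⟨r, rfl⟩
    unfold height at hp hq
    simp only [levelLine, height, Set.mem_ofPred_eq, AffineMap.lineMap_apply, vsub_eq_sub,
      vadd_eq_add, PiLp.add_apply, PiLp.smul_apply, PiLp.sub_apply, smul_eq_mul]
    linear_combination (1 - r) * hp + r * hq
  · intro hx
    have hx : height x θ = c := hx
    unfold height at hp hq hx
    have hd : (q 0 - p 0) ^ 2 + (q 1 - p 1) ^ 2 ≠ 0 := by
      intro h
      apply hpq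
      ext i
      fin_cases i
      · simp only [Fin.zero_eta]; nlinarith [sq_nonneg (q 0 - p 0), sq_nonneg (q 1 - p 1)]
      · simp only [Fin.mk_one]; nlinarith [sq_nonneg (q 0 - p 0), sq_nonneg (q 1 - p 1)]
    have hcross : (x 0 - p 0) * (q 1 - p 1) = (x 1 - p 1) * (q 0 - p 0) := by
      have h2 := Real.sin_sq_add_cos_sq θ
      linear_combination
        (-((x 0 - p 0) * (q 1 - p 1) - (x 1 - p 1) * (q 0 - p 0))) * h2 +
        (Real.cos θ * (q 1 - p 1) - Real.sin θ * (q 0 - p 0)) * (hx - hp) +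
        (Real.sin θ * (x 0 - p 0) - Real.cos θ * (x 1 - p 1)) * (hq - hp)
    refine ⟨((x 0 - p 0) * (q 0 - p 0) + (x 1 - p 1) * (q 1 - p 1)) /
      ((q 0 - p 0) ^ 2 + (q 1 - p 1) ^ 2), ?_⟩
    ext i
    fin_cases i
    · simp [AffineMap.lineMap_apply]
      field_simp
      linear_combination (-(q 1 - p 1)) * hcross
    · simp [AffineMap.lineMap_apply]
      field_simp
      linear_combination (q 0 - p 0) * hcross

lemma exists_height_eq (p q : Pt2) (a : ℝ) :
    ∃ θ ∈ Ico a (a + Real.pi), height p θ = height q θ := by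
  have hpi := Real.pi_pos
  have hle : a ≤ a + Real.pi := by linarith
  have hcont : ContinuousOn (fun θ => height p θ - height q θ) (uIcc a (a + Real.pi)) :=
    ((continuous_height p).sub (continuous_height q)).continuousOn
  have h0 : (0 : ℝ) ∈ uIcc (height p a - height q a)
      (height p (a + Real.pi) - height q (a + Real.pi)) := by
    rw [height_add_pi, height_add_pi, Set.mem_uIcc]
    rcases le_total (height p a) (height q a) with h | h
    · left; constructor <;> linarith
    · right; constructor <;> linarith
  obtain ⟨θ, hθ, he⟩ := intermediate_value_uIcc hcont h0
  rw [uIcc_of_le hle] at hθ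
  rcases hθ.2.lt_or_eq with h | rfl
  · exact ⟨θ, ⟨hθ.1, h⟩, sub_eq_zero.1 he⟩
  · refine ⟨a, ⟨le_rfl, by linarith⟩, ?_⟩
    simp only [height_add_pi] at he
    linarith

lemma ncard_inter_levelLine (P : Finset Pt2) (θ c : ℝ) :
    ((P : Set Pt2) ∩ levelLine θ c).ncard = countGE P θ c - countGT P θ c := by
  rw [← countGT_add_card_level, Nat.add_sub_cancel_left, ← Set.ncard_coe_finset]
  congr 1
  ext p
  simp [levelLine]

lemma levelLine_mem_detLines {P : Finset Pt2} {θ c : ℝ}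
    (h : countGT P θ c + 2 ≤ countGE P θ c) : levelLine θ c ∈ detLines (P : Set Pt2) := by
  obtain ⟨p, -, q, -, hpq, hp, hq⟩ := exists_ne_height_eq h
  refine ⟨⟨p, q, hpq, (affineSpan_pair_eq_levelLine hpq hp hq).symm⟩, ?_⟩
  rw [ncard_inter_levelLine]
  omega

lemma exists_levelLine_eq {P : Finset Pt2} {L : Set Pt2} (hL : L ∈ detLines (P : Set Pt2))
    (a : ℝ) : ∃ θ ∈ Ico a (a + Real.pi), ∃ c, countGT P θ c + 2 ≤ countGE P θ c ∧
      levelLine θ c = L := by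
  obtain ⟨⟨p, q, hpq, rfl⟩, hcard⟩ := hL
  obtain ⟨θ, hθ, he⟩ := exists_height_eq p q a
  have h := affineSpan_pair_eq_levelLine hpq he rfl
  refine ⟨θ, hθ, height q θ, ?_, h.symm⟩
  rw [h, ncard_inter_levelLine] at hcard
  omega

lemma finite_detLines (P : Finset Pt2) : (detLines (P : Set Pt2)).Finite := by
  refine ((events P).finite_toSet.image fun v => levelLine v.1 v.2).subset fun L hL => ?_
  obtain ⟨θ, hθ, c, hc, rfl⟩ := exists_levelLine_eq hL 0
  refine ⟨(θ, c), ?_, rfl⟩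
  rw [Finset.mem_coe, mem_events]
  exact ⟨⟨hθ.1, by linarith [hθ.2, Real.pi_pos]⟩, hc⟩

lemma sum_events_half_turn {P : Finset Pt2} {a : ℝ} (ha : 0 ≤ a) (ha' : a ≤ Real.pi) (f : ℕ → ℤ) :
    ∑ v ∈ (events P).filter (fun v => v.1 ∈ Ico a (a + Real.pi)),
      f (countGE P v.1 v.2 - countGT P v.1 v.2) =
    ∑ L ∈ (finite_detLines P).toFinset, f ((P : Set Pt2) ∩ L).ncard := by
  refine Finset.sum_bij (fun v _ => levelLine v.1 v.2) ?_ ?_ ?_ ?_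
  · intro v hv
    rw [Finset.mem_filter, mem_events] at hv
    rw [Set.Finite.mem_toFinset]
    exact levelLine_mem_detLines hv.1.2
  · rintro ⟨θ, c⟩ hv ⟨φ, d⟩ hw he
    rw [Finset.mem_filter, mem_events] at hv hw
    obtain ⟨p, -, q, -, hpq, hp, hq⟩ := exists_ne_height_eq hv.1.2
    simp only at hp hq he
    have hp' : height p φ = d := (he ▸ hp : p ∈ levelLine φ d)
    have hq' : height q φ = d := (he ▸ hq : q ∈ levelLine φ d)
    have hsin := sin_sub_eq_zero hpq (hp.trans hq.symm) (hp'.trans hq'.symm)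
    have h1 := hv.2
    have h2 := hw.2
    simp only [mem_Ico] at h1 h2
    have : θ = φ := sub_eq_zero.1
      ((Real.sin_eq_zero_iff_of_lt_of_lt (by linarith) (by linarith)).1 hsin)
    subst this
    rw [← hp, ← hp']
  · intro L hL
    rw [Set.Finite.mem_toFinset] at hL
    obtain ⟨θ, hθ, c, hc, rfl⟩ := exists_levelLine_eq hL a
    refine ⟨(θ, c), ?_, rfl⟩
    rw [Finset.mem_filter, mem_events]
    exact ⟨⟨⟨by linarith [hθ.1], by linarith [hθ.2]⟩, hc⟩, hθ⟩
  · intro v _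
    rw [ncard_inter_levelLine]

lemma sum_events_eq (P : Finset Pt2) (f : ℕ → ℤ) :
    ∑ v ∈ events P, f (countGE P v.1 v.2 - countGT P v.1 v.2) =
    2 * ∑ L ∈ (finite_detLines P).toFinset, f ((P : Set Pt2) ∩ L).ncard := by
  have h0 := sum_events_half_turn (P := P) le_rfl Real.pi_pos.le f
  have h1 := sum_events_half_turn (P := P) Real.pi_pos.le le_rfl f
  rw [two_mul]
  nth_rw 1 [← h0]
  rw [← h1, ← Finset.sum_filter_add_sum_filter_not (events P)
    (fun v => v.1 ∈ Ico 0 (0 + Real.pi))]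
  congr 2
  ext v
  simp only [Finset.mem_filter, mem_events, mem_Ico, zero_add]
  constructor
  · rintro ⟨h, hn⟩
    exact ⟨h, not_lt.1 fun hlt => hn ⟨h.1.1, hlt⟩, by linarith [h.1.2]⟩
  · rintro ⟨h, hn⟩
    exact ⟨h, fun hlt => hn.1.not_gt hlt.2⟩

lemma sum_mul_lineCount (P : Finset Pt2) :
    ∑ k ∈ Finset.Icc 2 P.card, (k : ℤ) * lineCount (P : Set Pt2) k =
      ∑ L ∈ (finite_detLines P).toFinset, (((P : Set Pt2) ∩ L).ncard : ℤ) := by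
  classical
  rw [← Finset.sum_fiberwise_of_maps_to (t := Finset.Icc 2 P.card)
    (g := fun L => ((P : Set Pt2) ∩ L).ncard)]
  · refine Finset.sum_congr rfl fun k hk => ?_
    rw [Finset.sum_congr rfl fun L hL => by rw [(Finset.mem_filter.1 hL).2], Finset.sum_const,
      nsmul_eq_mul, mul_comm]
    congr 2
    rw [lineCount, ← Set.ncard_coe_finset]
    congr 1
    ext L
    rw [Finset.mem_Icc] at hk
    simp only [detLines, Finset.coe_filter, Set.Finite.mem_toFinset, Set.mem_ofPred_eq]
    constructor
    · rintro ⟨h, rfl⟩; exact ⟨⟨h, hk.1⟩, rfl⟩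
    · rintro ⟨h, rfl⟩; exact ⟨h.1, rfl⟩
  · intro L hL
    rw [Set.Finite.mem_toFinset] at hL
    rw [Finset.mem_Icc, ← Set.ncard_coe_finset P]
    exact ⟨hL.2, Set.ncard_le_ncard inter_subset_left P.finite_toSet⟩

theorem stmt2 (S : Set Pt2) (hS : S.Finite) (hcol : ¬ Collinear ℝ S) :
    3 * ((detLines S).ncard : ℤ) - 3 ≥
      ∑ k ∈ Finset.Icc 2 S.ncard, (k : ℤ) * lineCount S k := by
  lift S to Finset Pt2 using hS
  rw [Set.ncard_coe_finset, sum_mul_lineCount, Set.ncard_eq_toFinset_card _ (finite_detLines S)]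
  have h1 := sum_events_le hcol
  have h2 := sum_events_eq S fun k => (k : ℤ)
  have h3 := sum_events_eq S fun _ => 1
  have h4 : ((∑ v ∈ events S, (countGE S v.1 v.2 - countGT S v.1 v.2 - 1) : ℕ) : ℤ) +
      (events S).card = ∑ v ∈ events S, ((countGE S v.1 v.2 - countGT S v.1 v.2 : ℕ) : ℤ) := by
    rw [Finset.card_eq_sum_ones, ← Nat.cast_add, ← Finset.sum_add_distrib, Nat.cast_sum]
    refine Finset.sum_congr rfl fun v hv => ?_
    have := (mem_events.1 hv).2
    congr 1
    omega
  simp only [Finset.sum_const, nsmul_eq_mul, mul_one] at h3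
  omega
end
end

section
/- For any finite set S of points in ℝ², not all collinear, t₂ + t₃ ≥ 2 + (1/6)·Σ_{i≥2} i·r_i, where r_i is the number of points of S incident to exactly i determined lines. -/
open Set

noncomputable section

/-- `ptCount S i` is the number of points of `S` incident to exactly `i`
determined lines of `S`. -/
def ptCount (S : Set Pt2) (i : ℕ) : ℕ :=
  {p ∈ S | {L ∈ detLines S | p ∈ L}.ncard = i}.ncard

/-- Twice the signed area of the triangle `p q r`. -/
def orient (p q r : Pt2) : ℝ := (q 0 - p 0) * (r 1 - p 1) - (q 1 - p 1) * (r 0 - p 0)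

/-- The inner product of `q - p` and `r - p`. -/
def proj (p q r : Pt2) : ℝ := (q 0 - p 0) * (r 0 - p 0) + (q 1 - p 1) * (r 1 - p 1)

/-- The line through `p` and `q`, described by its equation. -/
def lineThrough (p q : Pt2) : Set Pt2 := {x | orient p q x = 0}

/-- The coordinates of a point, ordered lexicographically. -/
def lexKey (p : Pt2) : ℝ ×ₗ ℝ := toLex (p 0, p 1)

/-- The points of `S` on the line through `e` and `r` all lie on the ray from `e` to `r`. -/
def IsFirst (S : Set Pt2) (e r : Pt2) : Prop := ∀ x ∈ S, orient e r x = 0 → 0 ≤ proj e r x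

/-- The line through `e` and `o`, rotated counterclockwise around `e`, first meets a further point
of `S` in `r`, and `e` is an end point of `S` on the line reached. -/
structure IsRotation (S : Set Pt2) (e o r : Pt2) : Prop where
  mem : r ∈ S
  orient_pos : 0 < orient e o r
  isFirst : IsFirst S e r
  orient_nonneg : ∀ x ∈ S, 0 < orient e o x → 0 ≤ orient e r x

/-- The set `S` lies to the left of the line from `e` to `r`, and `e` is its first point there. -/
structure IsHullEdge (S : Set Pt2) (e r : Pt2) : Prop where
  left_mem : e ∈ S
  right_mem : r ∈ S
  ne : e ≠ r
  isFirst : IsFirst S e r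
  orient_nonneg : ∀ x ∈ S, 0 ≤ orient e r x

lemma pt_ext {p q : Pt2} (h0 : p 0 = q 0) (h1 : p 1 = q 1) : p = q := by
  ext i; fin_cases i <;> assumption

lemma lineMap_coord (p q : Pt2) (t : ℝ) (i : Fin 2) :
    (AffineMap.lineMap p q t : Pt2) i = p i + t * (q i - p i) := by
  simp [AffineMap.lineMap_apply]; ring

lemma orient_lineMap_right (p q r : Pt2) (t : ℝ) :
    orient p q (AffineMap.lineMap p r t) = t * orient p q r := by
  simp only [orient, lineMap_coord]; ring

lemma orient_lineMap_mid (p q r : Pt2) (t : ℝ) :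
    orient p (AffineMap.lineMap p q t) r = t * orient p q r := by
  simp only [orient, lineMap_coord]; ring

lemma proj_lineMap_right (p q r : Pt2) (t : ℝ) :
    proj p q (AffineMap.lineMap p r t) = t * proj p q r := by
  simp only [proj, lineMap_coord]; ring

lemma orient_swap (p q r : Pt2) : orient p r q = -orient p q r := by
  simp only [orient]; ring

lemma proj_self_pos {p q : Pt2} (h : p ≠ q) : 0 < proj p q q := by
  by_contra! h'
  simp only [proj] at h'
  have h0 : q 0 - p 0 = 0 := by nlinarith [sq_nonneg (q 0 - p 0), sq_nonneg (q 1 - p 1)]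
  have h1 : q 1 - p 1 = 0 := by nlinarith [sq_nonneg (q 0 - p 0), sq_nonneg (q 1 - p 1)]
  exact h (pt_ext (by linarith) (by linarith))

lemma exists_eq_lineMap {p q x : Pt2} (h : p ≠ q) (hx : orient p q x = 0) :
    ∃ t : ℝ, x = AffineMap.lineMap p q t := by
  have hp := (proj_self_pos h).ne'
  refine ⟨proj p q x / proj p q q, pt_ext ?_ ?_⟩ <;> rw [lineMap_coord] <;> field_simp <;>
    simp only [proj, orient] at *
  · linear_combination (-(q 1 - p 1)) * hx
  · linear_combination (q 0 - p 0) * hx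

lemma ne_of_orient_ne_zero {p q r : Pt2} (h : orient p q r ≠ 0) : p ≠ q ∧ p ≠ r := by
  constructor <;> rintro rfl <;> apply h <;> simp [orient]

lemma IsFirst.exists_pos {S : Set Pt2} {e r x : Pt2} (h : IsFirst S e r) (her : e ≠ r)
    (hx : x ∈ S) (hxe : e ≠ x) (h0 : orient e r x = 0) :
    ∃ t : ℝ, 0 < t ∧ x = AffineMap.lineMap e r t := by
  obtain ⟨t, rfl⟩ := exists_eq_lineMap her h0
  refine ⟨t, ?_, rfl⟩
  have h1 := h _ hx h0
  rw [proj_lineMap_right] at h1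
  have h2 : 0 ≤ t := nonneg_of_mul_nonneg_left h1 (proj_self_pos her)
  refine h2.lt_of_ne fun h3 => hxe ?_
  rw [← h3, AffineMap.lineMap_apply_zero]

/-! ### Lines -/

lemma affineSpan_pair_eq_lineThrough {p q : Pt2} (h : p ≠ q) :
    (affineSpan ℝ ({p, q} : Set Pt2) : Set Pt2) = lineThrough p q := by
  ext x
  simp only [SetLike.mem_coe, mem_affineSpan_pair_iff_exists_lineMap_eq, lineThrough, mem_ofPred_eq]
  constructor
  · rintro ⟨t, rfl⟩
    rw [orient_lineMap_right]; simp [orient]; right; ring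
  · intro hx
    obtain ⟨t, ht⟩ := exists_eq_lineMap h hx
    exact ⟨t, ht.symm⟩

lemma isLine_lineThrough {p q : Pt2} (h : p ≠ q) : IsLine (lineThrough p q) :=
  ⟨p, q, h, (affineSpan_pair_eq_lineThrough h).symm⟩

lemma left_mem_lineThrough (p q : Pt2) : p ∈ lineThrough p q := by
  simp [lineThrough, orient]

lemma right_mem_lineThrough (p q : Pt2) : q ∈ lineThrough p q := by
  simp [lineThrough, orient]; ring

lemma IsLine.eq_lineThrough {L : Set Pt2} (hL : IsLine L) {p q : Pt2} (h : p ≠ q) (hp : p ∈ L)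
    (hq : q ∈ L) : L = lineThrough p q := by
  obtain ⟨a, b, hab, rfl⟩ := hL
  rw [← affineSpan_pair_eq_lineThrough h]
  congr 1
  symm
  exact affineSpan_pair_eq_of_mem_of_mem_of_ne hp hq h

lemma exists_orient_ne_zero {S : Set Pt2} (hcol : ¬ Collinear ℝ S) {p q : Pt2} (h : p ≠ q) :
    ∃ x ∈ S, orient p q x ≠ 0 := by
  by_contra! hc
  refine hcol ((collinear_iff_exists_forall_eq_smul_vadd S).2 ⟨p, q - p, fun x hx => ?_⟩)
  obtain ⟨t, rfl⟩ := exists_eq_lineMap h (hc x hx)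
  exact ⟨t, by simp [AffineMap.lineMap_apply]⟩

/-! ### Rotating a line until it meets a further point -/

lemma isRotation_of_max {S : Set Pt2} {e o r : Pt2} (heo : e ≠ o) (hr : r ∈ S)
    (hr0 : orient e o r ≠ 0)
    (hmax : ∀ x ∈ S, orient e o x ≠ 0 → proj e o x / orient e o x ≤ proj e o r / orient e o r)
    (hmax' : ∀ x ∈ S, orient e o x ≠ 0 → proj o e x / orient o e x ≤ proj e o r / orient e o r) :
    IsRotation S e o r := by
  have hd := proj_self_pos heo
  have key : ∀ t : ℝ, AffineMap.lineMap e r t ∈ S → t ≠ 0 → 0 ≤ t * orient e o r := by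
    intro t ht ht0
    by_contra! hneg
    have h1 := hmax' _ ht (by rw [orient_lineMap_right]; exact hneg.ne)
    have h2 : orient o e (AffineMap.lineMap e r t) = -(t * orient e o r) := by
      simp only [orient, lineMap_coord]; ring
    have h3 : proj o e (AffineMap.lineMap e r t) = proj e o o - t * proj e o r := by
      simp only [proj, lineMap_coord]; ring
    have h4 : proj e o r / orient e o r = (-(t * proj e o r)) / (-(t * orient e o r)) := by
      field_simp
    rw [h2, h3, h4, div_le_div_iff_of_pos_right (by linarith)] at h1
    linarith
  have hpos : 0 < orient e o r := by
    have := key 1 (by simpa using hr) one_ne_zero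
    exact lt_of_le_of_ne (by linarith) hr0.symm
  refine ⟨hr, hpos, fun x hx h0 => ?_, fun x hx hx0 => ?_⟩
  · have her := (ne_of_orient_ne_zero hr0).2
    obtain ⟨t, rfl⟩ := exists_eq_lineMap her h0
    rw [proj_lineMap_right]
    rcases eq_or_ne t 0 with rfl | ht
    · simp
    · exact mul_nonneg (nonneg_of_mul_nonneg_left (key t hx ht) hpos) (proj_self_pos her).le
  · have h1 := hmax x hx hx0.ne'
    rw [div_le_div_iff₀ hx0 hpos] at h1
    have h2 : proj e o r * orient e o x - proj e o x * orient e o r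
        = proj e o o * orient e r x := by
      simp only [proj, orient]; ring
    exact nonneg_of_mul_nonneg_right (by linarith) hd

lemma exists_isRotation {S : Set Pt2} (hS : S.Finite) (hcol : ¬ Collinear ℝ S) {p q : Pt2}
    (hpq : p ≠ q) :
    (∃ r, IsRotation S p q r) ∨ ∃ r, IsRotation S q p r := by
  have hF : {x ∈ S | orient p q x ≠ 0}.Finite := hS.subset (sep_subset _ _)
  have hne : {x ∈ S | orient p q x ≠ 0}.Nonempty := exists_orient_ne_zero hcol hpq
  have hopp : ∀ x, orient q p x = -orient p q x := fun x => by simp only [orient]; ring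
  obtain ⟨a, ⟨ha, ha0⟩, hamax⟩ :=
    exists_max_image _ (fun x => proj p q x / orient p q x) hF hne
  obtain ⟨b, ⟨hb, hb0⟩, hbmax⟩ :=
    exists_max_image _ (fun x => proj q p x / orient q p x) hF hne
  rcases le_total (proj q p b / orient q p b) (proj p q a / orient p q a) with h | h
  · exact .inl ⟨a, isRotation_of_max hpq ha ha0 (fun x hx h0 => hamax x ⟨hx, h0⟩)
      fun x hx h0 => (hbmax x ⟨hx, h0⟩).trans h⟩
  · refine .inr ⟨b, isRotation_of_max hpq.symm hb ?_ (fun x hx h0 => hbmax x ⟨hx, ?_⟩)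
      fun x hx h0 => (hamax x ⟨hx, ?_⟩).trans h⟩
    · rwa [hopp, neg_ne_zero]
    all_goals rwa [hopp, neg_ne_zero] at h0

lemma IsRotation.unique {S : Set Pt2} {e o o' r r' : Pt2} (h : IsRotation S e o r)
    (h' : IsRotation S e o' r') (hL : lineThrough e r = lineThrough e r') (ho : o ∈ S)
    (ho' : o' ∈ S) (hadj : ∀ x ∈ S, x ∉ openSegment ℝ e o)
    (hadj' : ∀ x ∈ S, x ∉ openSegment ℝ e o') : o = o' := by
  have hr := (ne_of_orient_ne_zero h.orient_pos.ne').2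
  have hr' := (ne_of_orient_ne_zero h'.orient_pos.ne')
  have heo := (ne_of_orient_ne_zero h.orient_pos.ne').1
  have h0 : orient e r r' = 0 := by
    have := right_mem_lineThrough e r'
    rwa [← hL] at this
  obtain ⟨s, hs, rfl⟩ := h.isFirst.exists_pos hr h'.mem hr'.2 h0
  have h1 := h'.orient_pos
  rw [orient_lineMap_right] at h1
  have h2 : 0 < orient e o' r := pos_of_mul_pos_right h1 hs.le
  have h3 := h.orient_pos
  rcases lt_trichotomy (orient e o o') 0 with hlt | heq | hgt
  · have h4 := h'.orient_nonneg o ho (by rw [orient_swap]; linarith)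
    rw [orient_lineMap_mid, orient_swap e o r] at h4
    nlinarith
  · obtain ⟨k, rfl⟩ := exists_eq_lineMap heo heq
    rw [orient_lineMap_mid] at h2
    have hk : 0 < k := pos_of_mul_pos_left h2 h3.le
    rw [openSegment_eq_image_lineMap] at hadj hadj'
    rcases lt_trichotomy k 1 with hk1 | rfl | hk1
    · exact absurd ⟨k, ⟨hk, hk1⟩, rfl⟩ (hadj _ ho')
    · simp
    · refine absurd ⟨k⁻¹, ⟨by positivity, inv_lt_one_of_one_lt₀ hk1⟩, ?_⟩ (hadj' _ ho)
      apply pt_ext <;> simp only [lineMap_coord] <;> field_simp <;> ring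
  · have h4 := h.orient_nonneg o' ho' hgt
    rw [orient_swap] at h4
    linarith

lemma IsRotation.lineThrough_ne {S : Set Pt2} {e o r r' : Pt2} (h : IsRotation S e o r)
    (ho : o ∈ S) (h' : IsHullEdge S e r') : lineThrough e r ≠ lineThrough e r' := by
  intro hL
  have hr := (ne_of_orient_ne_zero h.orient_pos.ne').2
  have h0 : orient e r r' = 0 := by
    have := right_mem_lineThrough e r'
    rwa [← hL] at this
  obtain ⟨s, hs, rfl⟩ := h.isFirst.exists_pos hr h'.right_mem h'.ne h0
  have h1 := h'.orient_nonneg o ho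
  rw [orient_lineMap_mid, orient_swap] at h1
  nlinarith [h.orient_pos]

/-! ### Edges of the convex hull -/

/-- The set `S` lies to the left of the line from `f` to `g`, and `f` is its last point there. -/
structure IsSupport (S : Set Pt2) (f g : Pt2) : Prop where
  mem : f ∈ S
  ne : f ≠ g
  orient_nonneg : ∀ x ∈ S, 0 ≤ orient f g x
  isLast : ∀ x ∈ S, orient f g x = 0 → proj f g x ≤ 0

lemma IsSupport.exists_isHullEdge {S : Set Pt2} (hS : S.Finite) (hcol : ¬ Collinear ℝ S)
    {f g : Pt2} (h : IsSupport S f g) : ∃ r, IsHullEdge S f r ∧ 0 < orient f g r := by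
  have hd := proj_self_pos h.ne
  obtain ⟨r, ⟨hr, hr0⟩, hmax⟩ := exists_max_image {x ∈ S | orient f g x ≠ 0}
    (fun x => proj f g x / orient f g x) (hS.subset (sep_subset _ _))
    (exists_orient_ne_zero hcol h.ne)
  have hrpos : 0 < orient f g r := (h.orient_nonneg r hr).lt_of_ne hr0.symm
  have hid : ∀ x, proj f g r * orient f g x - proj f g x * orient f g r
        = proj f g g * orient f r x := fun x => by simp only [proj, orient]; ring
  have hfr := (ne_of_orient_ne_zero hr0).2
  refine ⟨r, ⟨h.mem, hr, hfr, fun x hx h0 => ?_, fun x hx => ?_⟩, hrpos⟩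
  · obtain ⟨t, rfl⟩ := exists_eq_lineMap hfr h0
    have h1 := h.orient_nonneg _ hx
    rw [orient_lineMap_right] at h1
    rw [proj_lineMap_right]
    exact mul_nonneg (nonneg_of_mul_nonneg_left h1 hrpos) (proj_self_pos hfr).le
  · refine nonneg_of_mul_nonneg_right (a := proj f g g) ?_ hd
    rw [← hid]
    rcases (h.orient_nonneg x hx).eq_or_lt with h0 | h0
    · have := h.isLast x hx h0.symm
      rw [← h0]
      nlinarith
    · have h1 := hmax x ⟨hx, h0.ne'⟩
      rw [div_le_div_iff₀ h0 hrpos] at h1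
      linarith

lemma IsSupport.exists_next {S : Set Pt2} (hS : S.Finite) (hcol : ¬ Collinear ℝ S)
    {f g : Pt2} (h : IsSupport S f g) :
    ∃ f' g', IsSupport S f' g' ∧ 0 < orient f g f' ∧ orient f' g' f = 0 := by
  obtain ⟨r, hr, hpos⟩ := h.exists_isHullEdge hS hcol
  obtain ⟨f', ⟨hf', hf0⟩, hmax⟩ := exists_max_image {x ∈ S | orient f r x = 0} (proj f r)
    (hS.subset (sep_subset _ _)) ⟨r, hr.right_mem, right_mem_lineThrough f r⟩
  have hff : f ≠ f' := by
    rintro rfl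
    have h1 := hmax r ⟨hr.right_mem, right_mem_lineThrough f r⟩
    have h2 := proj_self_pos hr.ne
    have h3 : proj f r f = 0 := by simp [proj]
    linarith
  obtain ⟨t, ht, hft⟩ := hr.isFirst.exists_pos hr.ne hf' hff hf0
  have ho : ∀ x, orient f' (f' + (r - f)) x = orient f r x := by
    intro x
    have : orient f' (f' + (r - f)) x = orient f r x - orient f r f' := by
      simp [orient]; ring
    rw [this, hf0, sub_zero]
  have hp : ∀ x, proj f' (f' + (r - f)) x = proj f r x - proj f r f' := by
    intro x; simp [proj]; ring
  refine ⟨f', f' + (r - f), ⟨hf', ?_, fun x hx => ?_, fun x hx h0 => ?_⟩, ?_, ?_⟩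
  · simpa [sub_eq_zero] using hr.ne.symm
  · rw [ho]; exact hr.orient_nonneg x hx
  · rw [ho] at h0
    rw [hp]
    linarith [hmax x ⟨hx, h0⟩]
  · rw [hft, orient_lineMap_right]; positivity
  · rw [ho]; exact left_mem_lineThrough f r

lemma lexKey_injective : Function.Injective lexKey := by
  intro p q h
  have := toLex.injective h
  exact pt_ext (congrArg Prod.fst this) (congrArg Prod.snd this)

lemma lexKey_lt_iff {p q : Pt2} :
    lexKey p < lexKey q ↔ p 0 < q 0 ∨ p 0 = q 0 ∧ p 1 < q 1 := by
  simp [lexKey, Prod.Lex.toLex_lt_toLex]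

lemma exists_isSupport {S : Set Pt2} (hS : S.Finite) (hne : S.Nonempty) :
    ∃ f g, IsSupport S f g := by
  obtain ⟨f, hf, hmin⟩ := exists_min_image S lexKey hS hne
  have hle : ∀ x ∈ S, f 0 < x 0 ∨ f 0 = x 0 ∧ f 1 ≤ x 1 := by
    intro x hx
    have := hmin x hx
    simpa [lexKey, Prod.Lex.toLex_le_toLex] using this
  refine ⟨f, f + !₂[0, -1], hf, fun h => ?_, fun x hx => ?_, fun x hx h0 => ?_⟩
  · simpa using congrArg (fun p : Pt2 => p 1) h
  · have := hle x hx
    simp [orient]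
    rcases this with h | h
    · exact h.le
    · exact h.1.le
  · have := hle x hx
    simp [orient] at h0
    simp [proj]
    rcases this with h | h
    · linarith
    · exact h.2

lemma exists_three_isHullEdge {S : Set Pt2} (hS : S.Finite) (hcol : ¬ Collinear ℝ S) :
    ∃ a b c a' b' c', IsHullEdge S a a' ∧ IsHullEdge S b b' ∧ IsHullEdge S c c' ∧
      a ≠ b ∧ a ≠ c ∧ b ≠ c := by
  have hne : S.Nonempty := by
    by_contra! h
    exact hcol (h ▸ collinear_empty ℝ Pt2)
  obtain ⟨a, ga, ha⟩ := exists_isSupport hS hne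
  obtain ⟨b, gb, hb, hab, hba⟩ := ha.exists_next hS hcol
  obtain ⟨c, gc, hc, hbc, -⟩ := hb.exists_next hS hcol
  obtain ⟨a', ha', -⟩ := ha.exists_isHullEdge hS hcol
  obtain ⟨b', hb', -⟩ := hb.exists_isHullEdge hS hcol
  obtain ⟨c', hc', -⟩ := hc.exists_isHullEdge hS hcol
  refine ⟨a, b, c, a', b', c', ha', hb', hc', (ne_of_orient_ne_zero hab.ne').2, ?_,
    (ne_of_orient_ne_zero hbc.ne').2⟩
  rintro rfl
  exact hbc.ne hba.symm

/-! ### Counting incidences -/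

lemma lexKey_lt_lineMap {p q : Pt2} (h : lexKey p < lexKey q) {t : ℝ} (ht : 0 < t) :
    lexKey p < lexKey (AffineMap.lineMap p q t) := by
  rw [lexKey_lt_iff] at *
  simp only [lineMap_coord]
  rcases h with h | ⟨h0, h1⟩
  · left; nlinarith
  · right; exact ⟨by rw [h0]; ring, by nlinarith⟩

lemma lineMap_lexKey_lt {p q : Pt2} (h : lexKey q < lexKey p) {t : ℝ} (ht : 0 < t) :
    lexKey (AffineMap.lineMap p q t) < lexKey p := by
  rw [lexKey_lt_iff] at *
  simp only [lineMap_coord]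
  rcases h with h | ⟨h0, h1⟩
  · left; nlinarith
  · right; exact ⟨by rw [h0]; ring, by nlinarith⟩

lemma exists_lexKey_pred {S : Set Pt2} (hS : S.Finite) {L : Set Pt2} (hL : IsLine L) {q : Pt2}
    (hqL : q ∈ L) (h : ∃ p ∈ S ∩ L, lexKey p < lexKey q) :
    ∃ p ∈ S ∩ L, lexKey p < lexKey q ∧ ∀ x ∈ S, x ∉ openSegment ℝ p q := by
  obtain ⟨p, ⟨hp, hpq⟩, hmax⟩ := exists_max_image {p ∈ S ∩ L | lexKey p < lexKey q} lexKey
    (hS.subset fun x hx => hx.1.1) h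
  refine ⟨p, hp, hpq, fun x hx hxs => ?_⟩
  rw [openSegment_eq_image_lineMap] at hxs
  obtain ⟨t, ⟨ht0, ht1⟩, rfl⟩ := hxs
  have hne : p ≠ q := fun h => hpq.ne (congrArg lexKey h)
  have hxL : AffineMap.lineMap p q t ∈ L := by
    rw [hL.eq_lineThrough hne hp.2 hqL]
    change orient p q _ = 0
    rw [orient_lineMap_right, show orient p q q = 0 from right_mem_lineThrough p q, mul_zero]
  have h1 := lineMap_lexKey_lt hpq (show 0 < 1 - t by linarith)
  rw [AffineMap.lineMap_apply_one_sub] at h1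
  exact (lexKey_lt_lineMap hpq ht0).not_ge (hmax _ ⟨⟨hx, hxL⟩, h1⟩)

/-- The lexicographically extreme points of `S` on `L`. -/
def lineEnds (S L : Set Pt2) : Set Pt2 :=
  {e ∈ S ∩ L | (∀ x ∈ S ∩ L, lexKey e ≤ lexKey x) ∨ ∀ x ∈ S ∩ L, lexKey x ≤ lexKey e}

lemma ncard_lineEnds_le (S L : Set Pt2) : (lineEnds S L).ncard ≤ 2 := by
  have hsub : lineEnds S L ⊆ {e ∈ S ∩ L | ∀ x ∈ S ∩ L, lexKey e ≤ lexKey x} ∪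
      {e ∈ S ∩ L | ∀ x ∈ S ∩ L, lexKey x ≤ lexKey e} := by
    rintro e ⟨he, h | h⟩
    · exact .inl ⟨he, h⟩
    · exact .inr ⟨he, h⟩
  have h1 : {e ∈ S ∩ L | ∀ x ∈ S ∩ L, lexKey e ≤ lexKey x}.Subsingleton :=
    fun a ha b hb => lexKey_injective ((ha.2 b hb.1).antisymm (hb.2 a ha.1))
  have h2 : {e ∈ S ∩ L | ∀ x ∈ S ∩ L, lexKey x ≤ lexKey e}.Subsingleton :=
    fun a ha b hb => lexKey_injective ((hb.2 a ha.1).antisymm (ha.2 b hb.1))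
  have h3 := ncard_le_ncard hsub (h1.finite.union h2.finite)
  have h4 := ncard_union_le {e ∈ S ∩ L | ∀ x ∈ S ∩ L, lexKey e ≤ lexKey x}
    {e ∈ S ∩ L | ∀ x ∈ S ∩ L, lexKey x ≤ lexKey e}
  have h5 := (ncard_le_one h1.finite).2 fun _ ha _ hb => h1 ha hb
  have h6 := (ncard_le_one h2.finite).2 fun _ ha _ hb => h2 ha hb
  omega

lemma IsFirst.mem_lineEnds {S : Set Pt2} {e r : Pt2} (h : IsFirst S e r) (he : e ∈ S)
    (her : e ≠ r) : e ∈ lineEnds S (lineThrough e r) := by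
  refine ⟨⟨he, left_mem_lineThrough e r⟩, ?_⟩
  rcases lt_or_gt_of_ne (lexKey_injective.ne her) with hlt | hlt
  · refine .inl fun x hx => ?_
    rcases eq_or_ne e x with rfl | hxe
    · rfl
    obtain ⟨t, ht, rfl⟩ := h.exists_pos her hx.1 hxe hx.2
    exact (lexKey_lt_lineMap hlt ht).le
  · refine .inr fun x hx => ?_
    rcases eq_or_ne e x with rfl | hxe
    · rfl
    obtain ⟨t, ht, rfl⟩ := h.exists_pos her hx.1 hxe hx.2
    exact (lineMap_lexKey_lt hlt ht).le

lemma lineThrough_mem_detLines {S : Set Pt2} (hS : S.Finite) {p q : Pt2} (hp : p ∈ S)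
    (hq : q ∈ S) (h : p ≠ q) : lineThrough p q ∈ detLines S :=
  ⟨isLine_lineThrough h, (one_lt_ncard (hS.subset inter_subset_left)).2
    ⟨p, ⟨hp, left_mem_lineThrough p q⟩, q, ⟨hq, right_mem_lineThrough p q⟩, h⟩⟩

lemma finite_detLines_s3 {S : Set Pt2} (hS : S.Finite) : (detLines S).Finite := by
  refine (hS.image2 lineThrough hS).subset fun L hL => ?_
  obtain ⟨p, hp, q, hq, h⟩ := (one_lt_ncard (hS.subset inter_subset_left)).1 hL.2
  exact ⟨p, hp.1, q, hq.1, (hL.1.eq_lineThrough h hp.2 hq.2).symm⟩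

lemma ncard_inter_le_add_one {S : Set Pt2} (hS : S.Finite) (L : Set Pt2) :
    (S ∩ L).ncard ≤ {q ∈ S ∩ L | ∃ p ∈ S ∩ L, lexKey p < lexKey q}.ncard + 1 := by
  have h1 : ((S ∩ L) \ {q ∈ S ∩ L | ∃ p ∈ S ∩ L, lexKey p < lexKey q}).Subsingleton := by
    intro a ha b hb
    by_contra hab
    rcases lt_or_gt_of_ne (lexKey_injective.ne hab) with h | h
    · exact hb.2 ⟨hb.1, a, ha.1, h⟩
    · exact ha.2 ⟨ha.1, b, hb.1, h⟩
  have h2 := ncard_le_ncard_sdiff_add_ncard (S ∩ L) {q ∈ S ∩ L | ∃ p ∈ S ∩ L, lexKey p < lexKey q}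
    (hS.subset fun x hx => hx.1.1)
  have h3 := (ncard_le_one h1.finite).2 fun _ ha _ hb => h1 ha hb
  omega

/-- **Melchior's inequality**. -/
theorem sum_ncard_inter_add_three_le {S : Set Pt2} (hS : S.Finite) (hcol : ¬ Collinear ℝ S) :
    ∑ L ∈ (finite_detLines_s3 hS).toFinset, (S ∩ L).ncard + 3 ≤ 3 * (detLines S).ncard := by
  classical
  set D := (finite_detLines_s3 hS).toFinset with hD
  have hmemD : ∀ {L}, L ∈ D ↔ L ∈ detLines S := by simp [hD]
  let P : Set Pt2 → Set Pt2 := fun L => {q ∈ S ∩ L | ∃ p ∈ S ∩ L, lexKey p < lexKey q}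
  have hP : ∀ L, (P L).Finite := fun L => hS.subset fun x hx => hx.1.1
  have hE : ∀ L, (lineEnds S L).Finite := fun L => hS.subset fun x hx => hx.1.1
  let A : Finset (Σ _ : Set Pt2, Pt2) := D.sigma fun L => (hP L).toFinset
  let C : Finset (Σ _ : Set Pt2, Pt2) := D.sigma fun L => (hE L).toFinset
  have hmemC : ∀ {e r}, e ∈ S → r ∈ S → e ≠ r → IsFirst S e r →
      (⟨lineThrough e r, e⟩ : Σ _ : Set Pt2, Pt2) ∈ C := by
    intro e r he hr her h
    simp only [C, Finset.mem_sigma, hmemD, Finite.mem_toFinset]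
    exact ⟨lineThrough_mem_detLines hS he hr her, h.mem_lineEnds he her⟩
  have hrot : ∀ x ∈ A, ∃ p e o r, p ∈ S ∩ x.1 ∧ lexKey p < lexKey x.2 ∧
      (∀ y ∈ S, y ∉ openSegment ℝ e o) ∧ (e = p ∧ o = x.2 ∨ e = x.2 ∧ o = p) ∧
      IsRotation S e o r := by
    rintro ⟨L, q⟩ hx
    simp only [A, P, Finset.mem_sigma, hmemD, Finite.mem_toFinset] at hx
    obtain ⟨hL, hq, hlt⟩ := hx
    obtain ⟨p, hp, hpq, hadj⟩ := exists_lexKey_pred hS hL.1 hq.2 hlt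
    rcases exists_isRotation hS hcol (fun h => hpq.ne (congrArg lexKey h)) with
      ⟨r, hr⟩ | ⟨r, hr⟩
    · exact ⟨p, p, q, r, hp, hpq, hadj, .inl ⟨rfl, rfl⟩, hr⟩
    · exact ⟨p, q, p, r, hp, hpq, by rwa [openSegment_symm], .inr ⟨rfl, rfl⟩, hr⟩
  choose! p e o r hp hlt hadj heo hr using hrot
  have hA : ∀ x ∈ A, IsLine x.1 ∧ x.2 ∈ S ∩ x.1 := by
    rintro ⟨L, q⟩ hx
    simp only [A, P, Finset.mem_sigma, hmemD, Finite.mem_toFinset] at hx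
    exact ⟨hx.1.1, hx.2.1⟩
  have hmem : ∀ x ∈ A, e x ∈ S ∧ o x ∈ S := by
    intro x hx
    rcases heo x hx with ⟨h1, h2⟩ | ⟨h1, h2⟩ <;> rw [h1, h2]
    · exact ⟨(hp x hx).1, (hA x hx).2.1⟩
    · exact ⟨(hA x hx).2.1, (hp x hx).1⟩
  let g : (Σ _ : Set Pt2, Pt2) → Σ _ : Set Pt2, Pt2 := fun x => ⟨lineThrough (e x) (r x), e x⟩
  have hg : Set.InjOn g A := by
    intro x hx y hy hxy
    simp only [g, Sigma.mk.injEq, heq_eq_eq] at hxy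
    obtain ⟨hl, he⟩ := hxy
    have ho : o x = o y := by
      have hry := hr y hy
      have hay := hadj y hy
      rw [← he] at hry hay hl
      exact (hr x hx).unique hry hl (hmem x hx).2 (hmem y hy).2 (hadj x hx) hay
    have hpq : p x = p y ∧ x.2 = y.2 := by
      have h1 := hlt x hx
      have h2 := hlt y hy
      rcases heo x hx with ⟨h3, h4⟩ | ⟨h3, h4⟩ <;> rcases heo y hy with ⟨h5, h6⟩ | ⟨h5, h6⟩ <;>
        rw [h3, h5] at he <;> rw [h4, h6] at ho
      · exact ⟨he, ho⟩
      · rw [he, ho] at h1; exact absurd h1 h2.not_gt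
      · rw [he, ho] at h1; exact absurd h1 h2.not_gt
      · exact ⟨ho, he⟩
    have hne : p x ≠ x.2 := fun h => (hlt x hx).ne (congrArg lexKey h)
    refine Sigma.ext ?_ (heq_of_eq hpq.2)
    rw [(hA x hx).1.eq_lineThrough hne (hp x hx).2 (hA x hx).2.2, hpq.1, hpq.2,
      ← (hA y hy).1.eq_lineThrough (hpq.1 ▸ hpq.2 ▸ hne) (hp y hy).2 (hA y hy).2.2]
  obtain ⟨a, b, c, a', b', c', ha, hb, hc, hab, hac, hbc⟩ := exists_three_isHullEdge hS hcol
  let H : Finset (Σ _ : Set Pt2, Pt2) :=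
    {⟨lineThrough a a', a⟩, ⟨lineThrough b b', b⟩, ⟨lineThrough c c', c⟩}
  have hH3 : H.card = 3 := by
    apply Finset.card_eq_three.2
    exact ⟨_, _, _, fun h => hab (congrArg Sigma.snd h), fun h => hac (congrArg Sigma.snd h),
      fun h => hbc (congrArg Sigma.snd h), rfl⟩
  have hH : ∀ y ∈ H, ∃ s, IsHullEdge S y.2 s ∧ y = ⟨lineThrough y.2 s, y.2⟩ := by
    intro y hy
    simp only [H, Finset.mem_insert, Finset.mem_singleton] at hy
    rcases hy with rfl | rfl | rfl
    exacts [⟨a', ha, rfl⟩, ⟨b', hb, rfl⟩, ⟨c', hc, rfl⟩]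
  have hdisj : Disjoint (A.image g) H := by
    rw [Finset.disjoint_left]
    intro y hy hyH
    obtain ⟨x, hx, rfl⟩ := Finset.mem_image.1 hy
    obtain ⟨s, hs, hys⟩ := hH _ hyH
    exact (hr x hx).lineThrough_ne (hmem x hx).2 hs (congrArg Sigma.fst hys)
  have hsub : A.image g ∪ H ⊆ C := by
    refine Finset.union_subset (Finset.image_subset_iff.2 fun x hx => ?_) fun y hy => ?_
    · have h := hr x hx
      exact hmemC (hmem x hx).1 h.mem (ne_of_orient_ne_zero h.orient_pos.ne').2 h.isFirst
    · obtain ⟨s, hs, hys⟩ := hH y hy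
      rw [hys]
      exact hmemC hs.left_mem hs.right_mem hs.ne hs.isFirst
  have hcard := Finset.card_le_card hsub
  rw [Finset.card_union_of_disjoint hdisj, Finset.card_image_of_injOn hg, hH3] at hcard
  have hCle : C.card ≤ D.card * 2 := by
    rw [Finset.card_sigma]
    refine Finset.sum_le_card_nsmul _ _ _ fun L _ => ?_
    rw [← ncard_eq_toFinset_card _ (hE L)]
    exact ncard_lineEnds_le S L
  have hAge : ∑ L ∈ D, (S ∩ L).ncard ≤ A.card + D.card := by
    rw [Finset.card_sigma, Finset.card_eq_sum_ones D, ← Finset.sum_add_distrib]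
    refine Finset.sum_le_sum fun L _ => ?_
    rw [← ncard_eq_toFinset_card _ (hP L)]
    exact ncard_inter_le_add_one hS L
  rw [ncard_eq_toFinset_card _ (finite_detLines_s3 hS), ← hD]
  omega

lemma lineCount_eq {S : Set Pt2} (hS : S.Finite) {k : ℕ} (hk : 2 ≤ k) :
    lineCount S k = ∑ L ∈ (finite_detLines_s3 hS).toFinset, if (S ∩ L).ncard = k then 1 else 0 := by
  classical
  rw [← Finset.card_filter, lineCount, ← ncard_coe_finset]
  congr 1
  ext L
  simp only [detLines, Finset.coe_filter, Finite.mem_toFinset, mem_ofPred_eq]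
  constructor
  · rintro ⟨h1, h2⟩; exact ⟨⟨h1, h2 ▸ hk⟩, h2⟩
  · rintro ⟨h1, h2⟩; exact ⟨h1.1, h2⟩

lemma sum_mul_ptCount_le {S : Set Pt2} (hS : S.Finite) (I : Finset ℕ) :
    ∑ i ∈ I, i * ptCount S i ≤ ∑ L ∈ (finite_detLines_s3 hS).toFinset, (S ∩ L).ncard := by
  classical
  set D := (finite_detLines_s3 hS).toFinset
  set T := hS.toFinset
  have hdeg : ∀ p, {L ∈ detLines S | p ∈ L}.ncard = (D.filter (p ∈ ·)).card := by
    intro p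
    rw [← ncard_coe_finset]
    congr 1
    ext L
    simp [D]
  have hpt : ∀ i, ptCount S i = (T.filter fun p => (D.filter (p ∈ ·)).card = i).card := by
    intro i
    rw [ptCount, ← ncard_coe_finset]
    congr 1
    ext p
    simp [T, hdeg]
  have hline : ∀ L, (S ∩ L).ncard = (T.filter (· ∈ L)).card := by
    intro L
    rw [← ncard_coe_finset]
    congr 1
    ext p
    simp [T]
  calc ∑ i ∈ I, i * ptCount S i
      = ∑ i ∈ I, ∑ p ∈ T with (D.filter (p ∈ ·)).card = i, (D.filter (p ∈ ·)).card := by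
        refine Finset.sum_congr rfl fun i _ => ?_
        rw [Finset.sum_congr rfl fun p hp => (Finset.mem_filter.1 hp).2, Finset.sum_const, hpt,
          smul_eq_mul, mul_comm]
    _ ≤ ∑ p ∈ T, (D.filter (p ∈ ·)).card :=
        Finset.sum_fiberwise_le_sum_of_sum_fiber_nonneg fun _ _ => Nat.zero_le _
    _ = ∑ L ∈ D, (S ∩ L).ncard := by
        simp_rw [hline]
        exact Finset.sum_card_bipartiteAbove_eq_sum_card_bipartiteBelow (· ∈ ·)

theorem stmt3 (S : Set Pt2) (hS : S.Finite) (hcol : ¬ Collinear ℝ S) :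
    ((lineCount S 2 + lineCount S 3 : ℕ) : ℝ) ≥
      2 + (1 / 6) * ∑ i ∈ Finset.Icc 2 (detLines S).ncard, (i : ℝ) * ptCount S i := by
  have hmel := sum_ncard_inter_add_three_le hS hcol
  have hsum := sum_mul_ptCount_le hS (Finset.Icc 2 (detLines S).ncard)
  set D := (finite_detLines_s3 hS).toFinset with hD
  have hlow : 4 * (3 * (detLines S).ncard) + ∑ L ∈ D, (S ∩ L).ncard ≤
      6 * (lineCount S 2 + lineCount S 3) + 4 * ∑ L ∈ D, (S ∩ L).ncard := by
    rw [lineCount_eq hS le_rfl, lineCount_eq hS (by norm_num), ← Finset.sum_add_distrib,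
      ncard_eq_toFinset_card _ (finite_detLines_s3 hS), ← hD, Finset.card_eq_sum_ones]
    simp only [Finset.mul_sum]
    rw [← Finset.sum_add_distrib, ← Finset.sum_add_distrib]
    refine Finset.sum_le_sum fun L hL => ?_
    have h2 : 2 ≤ (S ∩ L).ncard := ((Finite.mem_toFinset _).1 hL).2
    split_ifs <;> omega
  have hnat : 12 + ∑ i ∈ Finset.Icc 2 (detLines S).ncard, i * ptCount S i ≤
      6 * (lineCount S 2 + lineCount S 3) := by omega
  have hreal : (12 : ℝ) + ∑ i ∈ Finset.Icc 2 (detLines S).ncard, (i : ℝ) * ptCount S i ≤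
      6 * ((lineCount S 2 + lineCount S 3 : ℕ) : ℝ) := by exact_mod_cast hnat
  linarith
end
end
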